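/- arXiv:2310.09251 — 3 statements merged into one kernel-verified Lean document; each statement's English description precedes it below -/
import Mathlib

section
/- Let u ∈ L¹(ℝ^N) be continuous with |u| radially symmetric and decreasing, let f be continuous with F(t) := ∫_0^t f(τ) dτ satisfying |F(t)| ≤ C₀|t|^{(N+α)/N} for all |t| ≤ 1 and some C₀ > 0, and let θ ∈ (N, N+α]. Then M := sup_{x ∈ ℝ^N} |F(u(x))|(1+|x|^θ) < ∞, and for every ε > 0 there exists R > 0 such that for every x with |x| ≥ R: |(I_α∗F(u))(x)| ≤ I_α(x)(|∫_{ℝ^N} F(u)| + ε M) and (I_α∗F(u))(x) ≥ I_α(x)(∫_{ℝ^N} F(u) − ε M). -/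
open MeasureTheory Real Filter

noncomputable section

abbrev En (N : ℕ) := EuclideanSpace ℝ (Fin N)

/-- The Riesz potential constant `C_{N,α}`. -/
def Cna (N : ℕ) (α : ℝ) : ℝ :=
  Real.Gamma (((N : ℝ) - α) / 2) /
    (2 ^ α * Real.pi ^ ((N : ℝ) / 2) * Real.Gamma (α / 2))

/-- The Riesz convolution `(I_α ∗ g)(x)`. -/
def rieszConv (N : ℕ) (α : ℝ) (g : En N → ℝ) (x : En N) : ℝ :=
  Cna N α * ∫ y, g y * ‖x - y‖ ^ (α - (N : ℝ))

/-- `v` is radially symmetric and decreasing. -/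
def RadialDecreasing (N : ℕ) (v : En N → ℝ) : Prop :=
  ∃ h : ℝ → ℝ, AntitoneOn h (Set.Ici 0) ∧ ∀ x, v x = h ‖x‖


section Helpers

open Topology

theorem fr (N : ℕ) : Module.finrank ℝ (En N) = N := by simp

theorem u_decay (N : ℕ) (u : En N → ℝ) (huL1 : Integrable u)
    (hurad : RadialDecreasing N (fun x => |u x|)) :
    ∃ K : ℝ, 0 ≤ K ∧ ∀ x : En N, x ≠ 0 → |u x| ≤ K * ‖x‖ ^ (-(N : ℝ)) := by
  obtain ⟨h, hh, hu⟩ := hurad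
  set c := volume.real (Metric.ball (0 : En N) 1) with hc
  have hcpos : 0 < c := by
    rw [hc, measureReal_def]
    exact ENNReal.toReal_pos (Metric.measure_ball_pos _ _ one_pos).ne' measure_ball_lt_top.ne
  refine ⟨(∫ y, |u y|) / c, by positivity, fun x hx => ?_⟩
  have hxp : 0 < ‖x‖ := norm_pos_iff.2 hx
  have hball : volume.real (Metric.ball (0 : En N) ‖x‖) = ‖x‖ ^ N * c := by
    rw [measureReal_def, Measure.addHaar_ball_of_pos volume _ hxp, ENNReal.toReal_mul,
      ENNReal.toReal_ofReal (by positivity), fr, hc, measureReal_def]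
  have h1 : ∫ y in Metric.ball (0 : En N) ‖x‖, |u x| ≤ ∫ y in Metric.ball (0 : En N) ‖x‖, |u y| := by
    refine setIntegral_mono_on ?_ huL1.abs.integrableOn measurableSet_ball ?_
    · exact integrableOn_const measure_ball_lt_top.ne
    · intro y hy
      have hy' : ‖y‖ < ‖x‖ := by simpa using hy
      have e1 := hu x
      have e2 := hu y
      simp only at e1 e2
      rw [e1, e2]
      exact hh (norm_nonneg _) (norm_nonneg _) hy'.le
  have h2 : ∫ y in Metric.ball (0 : En N) ‖x‖, |u y| ≤ ∫ y, |u y| :=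
    setIntegral_le_integral huL1.abs (Eventually.of_forall fun _ => abs_nonneg _)
  rw [setIntegral_const, smul_eq_mul, hball] at h1
  rw [rpow_neg hxp.le, rpow_natCast, div_mul_eq_mul_div, le_div_iff₀ hcpos,
    ← div_eq_mul_inv, le_div_iff₀ (by positivity)]
  nlinarith

theorem bdd_aux (N : ℕ) (hN : 2 ≤ N) (α θ C₀ : ℝ)
    (hα : α ∈ Set.Ioo (0 : ℝ) (N : ℝ)) (hθ : θ ∈ Set.Ioc (N : ℝ) ((N : ℝ) + α))
    (hC₀ : 0 < C₀)
    (u : En N → ℝ) (huL1 : Integrable u) (huc : Continuous u)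
    (hurad : RadialDecreasing N (fun x => |u x|))
    (F : ℝ → ℝ) (hFc : Continuous F)
    (hFbound : ∀ t : ℝ, |t| ≤ 1 → |F t| ≤ C₀ * |t| ^ (((N : ℝ) + α) / N)) :
    BddAbove (Set.range fun x : En N => |F (u x)| * (1 + ‖x‖ ^ θ)) := by
  obtain ⟨K, hK, hu⟩ := u_decay N u huL1 hurad
  have hNp : (0 : ℝ) < N := by positivity
  have hθ0 : 0 < θ := hNp.trans hθ.1
  have hcont : Continuous (fun x : En N => |F (u x)| * (1 + ‖x‖ ^ θ)) := by
    have : Continuous (fun x : En N => ‖x‖ ^ θ) :=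
      continuous_norm.rpow_const (fun _ => Or.inr hθ0.le)
    fun_prop
  obtain ⟨B, hB⟩ := ((isCompact_closedBall (0 : En N) (max 1 K)).image hcont).bddAbove
  refine ⟨max B (C₀ * K ^ (((N : ℝ) + α) / N) * 2), ?_⟩
  rintro _ ⟨x, rfl⟩
  by_cases hx : ‖x‖ ≤ max 1 K
  · exact le_max_of_le_left (hB ⟨x, by simpa using hx, rfl⟩)
  · apply le_max_of_le_right
    push Not at hx
    have hx1 : 1 < ‖x‖ := (le_max_left _ _).trans_lt hx
    have hxK : K < ‖x‖ := (le_max_right _ _).trans_lt hx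
    have hx0 : 0 < ‖x‖ := by linarith
    have h1 := hu x (norm_pos_iff.1 hx0)
    have hle1 : |u x| ≤ 1 := by
      refine h1.trans ?_
      calc K * ‖x‖ ^ (-(N : ℝ)) ≤ ‖x‖ * ‖x‖ ^ (-(1 : ℝ)) := by
            gcongr
            · exact hx1.le
            · exact_mod_cast (by omega : 1 ≤ N)
        _ = 1 := by rw [rpow_neg_one]; field_simp
    have h2 := hFbound _ hle1
    have hp : 0 ≤ ((N : ℝ) + α) / N := by have := hα.1; positivity
    have h3 : |u x| ^ (((N : ℝ) + α) / N) ≤ K ^ (((N : ℝ) + α) / N) * ‖x‖ ^ (-((N : ℝ) + α)) := by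
      calc _ ≤ (K * ‖x‖ ^ (-(N : ℝ))) ^ (((N : ℝ) + α) / N) := by gcongr
        _ = _ := by
          rw [mul_rpow hK (by positivity), ← rpow_mul hx0.le]
          congr 2
          field_simp
    have h4 : 1 + ‖x‖ ^ θ ≤ 2 * ‖x‖ ^ ((N : ℝ) + α) := by
      have a1 : ‖x‖ ^ θ ≤ ‖x‖ ^ ((N : ℝ) + α) := rpow_le_rpow_of_exponent_le hx1.le hθ.2
      have a2 : 1 ≤ ‖x‖ ^ ((N : ℝ) + α) := one_le_rpow hx1.le (by linarith [hα.1])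
      linarith
    calc |F (u x)| * (1 + ‖x‖ ^ θ)
        ≤ (C₀ * (K ^ (((N : ℝ) + α) / N) * ‖x‖ ^ (-((N : ℝ) + α)))) * (2 * ‖x‖ ^ ((N : ℝ) + α)) := by
          gcongr
          exact h2.trans (by gcongr)
      _ = _ := by
          rw [rpow_neg hx0.le]
          field_simp

theorem g_integrable (N : ℕ) (θ M : ℝ) (hθ : (N : ℝ) < θ) (g : En N → ℝ)
    (hg : Continuous g) (hM : ∀ y, |g y| * (1 + ‖y‖ ^ θ) ≤ M) : Integrable g := by
  have hθ0 : 0 < θ := (Nat.cast_nonneg N).trans_lt hθ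
  have hi : Integrable (fun x : En N ↦ (1 + ‖x‖) ^ (-θ)) :=
    integrable_one_add_norm (by rw [fr]; exact hθ)
  refine (hi.const_mul (M * 2 ^ θ)).mono' hg.aestronglyMeasurable (Eventually.of_forall fun y => ?_)
  have hy := norm_nonneg y
  rw [rpow_neg (by positivity), ← div_eq_mul_inv, le_div_iff₀ (by positivity), Real.norm_eq_abs]
  have h1 : (1 + ‖y‖) ^ θ ≤ 2 ^ θ * (1 + ‖y‖ ^ θ) := by
    rcases le_total ‖y‖ 1 with h | h
    · calc (1 + ‖y‖) ^ θ ≤ 2 ^ θ := by gcongr; linarith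
        _ ≤ _ := le_mul_of_one_le_right (by positivity) (by linarith [rpow_nonneg hy θ])
    · calc (1 + ‖y‖) ^ θ ≤ (2 * ‖y‖) ^ θ := by gcongr; linarith
        _ = 2 ^ θ * ‖y‖ ^ θ := mul_rpow (by norm_num) hy
        _ ≤ _ := by gcongr; linarith
  calc |g y| * (1 + ‖y‖) ^ θ ≤ |g y| * (2 ^ θ * (1 + ‖y‖ ^ θ)) := by gcongr
    _ = (|g y| * (1 + ‖y‖ ^ θ)) * 2 ^ θ := by ring
    _ ≤ _ := by gcongr; exact hM y

/-- far part of the kernel -/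
def Gk (p : ℝ) (r : ℝ) : ℝ := if 1 / 2 ≤ r then r ^ p else 0
/-- near part of the kernel -/
def Hk (p : ℝ) (r : ℝ) : ℝ := if 1 / 2 ≤ r then 0 else r ^ p

theorem Gk_meas (p : ℝ) : Measurable (Gk p) :=
  Measurable.ite measurableSet_Ici (by fun_prop) (by fun_prop)

theorem Hk_meas (p : ℝ) : Measurable (Hk p) :=
  Measurable.ite measurableSet_Ici (by fun_prop) (by fun_prop)

theorem Hk_nonneg (p r : ℝ) (hr : 0 ≤ r) : 0 ≤ Hk p r := by
  unfold Hk; split_ifs <;> positivity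

theorem Gk_bound (p r : ℝ) (hp : p < 0) : ‖Gk p r‖ ≤ (1 / 2) ^ p := by
  unfold Gk; split_ifs with h
  · rw [Real.norm_of_nonneg (by positivity)]
    exact rpow_le_rpow_of_nonpos (by norm_num) h hp.le
  · simp; positivity

theorem Gk_tendsto (p : ℝ) : Tendsto (Gk p) (𝓝 1) (𝓝 1) := by
  have h : Tendsto (fun r : ℝ => r ^ p) (𝓝 1) (𝓝 1) := by
    simpa using (continuousAt_rpow_const 1 p (Or.inl one_ne_zero)).tendsto
  refine h.congr' ?_
  filter_upwards [Ici_mem_nhds (by norm_num : (1 / 2 : ℝ) < 1)] with r hr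
  exact (if_pos hr).symm

theorem Hk_integrable (N : ℕ) (hN : 2 ≤ N) (α : ℝ) (hα : α ∈ Set.Ioo (0 : ℝ) (N : ℝ)) :
    Integrable (fun z : En N => Hk (α - N) ‖z‖) := by
  have h : IntegrableOn (fun z : En N => ‖z‖ ^ (α - N)) (Metric.ball 0 (1 / 2)) := by
    refine integrableOn_ball_of_norm_le_rpow (C := 1) (α := N - α) (by rw [fr]; omega)
      (by rw [fr]; linarith [hα.1]) (Eventually.of_forall fun x => ?_) ?_
    · rw [Real.norm_of_nonneg (by positivity)]; simp
    · exact Measurable.aestronglyMeasurable (by fun_prop)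
  rw [← integrable_indicator_iff measurableSet_ball] at h
  refine h.congr (Eventually.of_forall fun z => ?_)
  by_cases hz : 1 / 2 ≤ ‖z‖
  · have : z ∉ Metric.ball (0 : En N) (1 / 2) := by simpa using hz
    simp only [Set.indicator_of_notMem this, Hk, if_pos hz]
  · have : z ∈ Metric.ball (0 : En N) (1 / 2) := by simpa using hz
    simp only [Set.indicator_of_mem this, Hk, if_neg hz]

theorem ratio_tendsto (N : ℕ) (y : En N) :
    Tendsto (fun x : En N => ‖x - y‖ / ‖x‖) (comap norm atTop) (𝓝 1) := by
  have h0 : Tendsto (fun x : En N => ‖y‖ / ‖x‖) (comap norm atTop) (𝓝 0) :=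
    tendsto_const_nhds.div_atTop tendsto_comap
  rw [tendsto_iff_norm_sub_tendsto_zero]
  refine squeeze_zero' (Eventually.of_forall fun _ => norm_nonneg _) ?_ h0
  filter_upwards [tendsto_comap.eventually (eventually_gt_atTop (0 : ℝ))] with x hx
  have : ‖x - y‖ / ‖x‖ - 1 = (‖x - y‖ - ‖x‖) / ‖x‖ := by field_simp
  rw [this, norm_div, norm_norm]
  gcongr
  have := abs_norm_sub_norm_le (x - y) x
  simpa using this

theorem main_tendsto (N : ℕ) (hN : 2 ≤ N) (α θ M : ℝ) (hα : α ∈ Set.Ioo (0 : ℝ) (N : ℝ))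
    (hθ : (N : ℝ) < θ) (g : En N → ℝ)
    (hg : Continuous g) (hM : ∀ y, |g y| * (1 + ‖y‖ ^ θ) ≤ M) :
    Tendsto (fun x : En N => ‖x‖ ^ ((N : ℝ) - α) * ∫ y, g y * ‖x - y‖ ^ (α - (N : ℝ)))
      (comap norm atTop) (𝓝 (∫ y, g y)) := by
  have hgi := g_integrable N θ M hθ g hg hM
  have hθ0 : 0 < θ := (Nat.cast_nonneg N).trans_lt hθ
  have hp : α - (N : ℝ) < 0 := by linarith [hα.2]
  have hM0 : 0 ≤ M := le_trans (by positivity) (hM 0)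
  have hpos : ∀ᶠ x : En N in comap norm atTop, 0 < ‖x‖ :=
    tendsto_comap.eventually (eventually_gt_atTop (0 : ℝ))
  have hGm : ∀ x : En N, AEStronglyMeasurable
      (fun y => g y * Gk (α - N) (‖x - y‖ / ‖x‖)) volume := fun x => by
    refine hg.aestronglyMeasurable.mul (Measurable.aestronglyMeasurable ?_)
    exact (Gk_meas _).comp (by fun_prop)
  have hGb : ∀ x y : En N, ‖g y * Gk (α - N) (‖x - y‖ / ‖x‖)‖ ≤ ‖g y‖ * (1 / 2) ^ (α - (N : ℝ)) :=
    fun x y => by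
      rw [norm_mul]
      gcongr
      exact Gk_bound _ _ hp
  have hA : Tendsto (fun x : En N => ∫ y, g y * Gk (α - N) (‖x - y‖ / ‖x‖))
      (comap norm atTop) (𝓝 (∫ y, g y)) := by
    refine tendsto_integral_filter_of_dominated_convergence
      (fun y => ‖g y‖ * (1 / 2) ^ (α - (N : ℝ))) (Eventually.of_forall hGm)
      (Eventually.of_forall fun x => Eventually.of_forall (hGb x)) (hgi.norm.mul_const _)
      (Eventually.of_forall fun y => ?_)
    simpa using ((Gk_tendsto (α - N)).comp (ratio_tendsto N y)).const_mul (g y)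
  have hHi := Hk_integrable N hN α hα
  set J := ∫ z : En N, Hk (α - N) ‖z‖ with hJ
  have hHx : ∀ x : En N, 0 < ‖x‖ → Integrable (fun y => Hk (α - N) (‖x - y‖ / ‖x‖)) ∧
      ∫ y, Hk (α - N) (‖x - y‖ / ‖x‖) = ‖x‖ ^ N * J := by
    intro x hx
    have e : (fun y => Hk (α - N) (‖x - y‖ / ‖x‖)) =
        fun y => (fun z : En N => Hk (α - N) ‖‖x‖⁻¹ • z‖) (x - y) := by
      funext y
      simp only [norm_smul, norm_inv, norm_norm]
      rw [div_eq_inv_mul]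
    have hI : Integrable (fun z : En N => Hk (α - N) ‖‖x‖⁻¹ • z‖) :=
      hHi.comp_smul (inv_ne_zero hx.ne')
    rw [e]
    refine ⟨hI.comp_sub_left x, ?_⟩
    rw [integral_sub_left_eq_self (fun z : En N => Hk (α - N) ‖‖x‖⁻¹ • z‖) volume x,
      Measure.integral_comp_inv_smul_of_nonneg volume (fun z : En N => Hk (α - N) ‖z‖) hx.le, fr,
      smul_eq_mul]
  have hBb : ∀ x : En N, 0 < ‖x‖ → ∀ y, ‖g y * Hk (α - N) (‖x - y‖ / ‖x‖)‖ ≤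
      M * (‖x‖ / 2) ^ (-θ) * Hk (α - N) (‖x - y‖ / ‖x‖) := by
    intro x hx y
    have hn : 0 ≤ Hk (α - N) (‖x - y‖ / ‖x‖) := Hk_nonneg _ _ (by positivity)
    rw [norm_mul, Real.norm_of_nonneg hn]
    by_cases h : 1 / 2 ≤ ‖x - y‖ / ‖x‖
    · simp only [Hk, if_pos h, mul_zero, le_refl]
    · gcongr
      rw [le_div_iff₀ hx] at h
      have h1 : ‖x‖ ≤ ‖x - y‖ + ‖y‖ := by
        simpa using norm_add_le (x - y) y
      have h2 : ‖x‖ / 2 ≤ ‖y‖ := by linarith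
      rw [rpow_neg (by positivity), ← div_eq_mul_inv, le_div_iff₀ (by positivity)]
      refine le_trans ?_ (hM y)
      rw [Real.norm_eq_abs]
      gcongr
      calc (‖x‖ / 2) ^ θ ≤ ‖y‖ ^ θ := by gcongr
        _ ≤ _ := by linarith
  have hB : Tendsto (fun x : En N => ∫ y, g y * Hk (α - N) (‖x - y‖ / ‖x‖))
      (comap norm atTop) (𝓝 0) := by
    have hz : Tendsto (fun x : En N => M * 2 ^ θ * J * ‖x‖ ^ (-(θ - N))) (comap norm atTop) (𝓝 0) := by
      simpa using ((tendsto_rpow_neg_atTop (by linarith : 0 < θ - N)).comp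
        (tendsto_comap (f := (norm : En N → ℝ)))).const_mul (M * 2 ^ θ * J)
    refine squeeze_zero_norm' ?_ hz
    filter_upwards [hpos] with x hx
    refine (norm_integral_le_of_norm_le ((hHx x hx).1.const_mul _)
      (Eventually.of_forall (hBb x hx))).trans (le_of_eq ?_)
    rw [integral_const_mul, (hHx x hx).2, rpow_neg (by positivity), div_rpow hx.le (by norm_num),
      neg_sub, rpow_sub hx, rpow_natCast]
    field_simp
  have hAB := hA.add hB
  rw [add_zero] at hAB
  refine hAB.congr' ?_
  filter_upwards [hpos] with x hx
  rw [← integral_const_mul, ← integral_add]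
  · refine integral_congr_ae (Eventually.of_forall fun y => ?_)
    have hs : Gk (α - N) (‖x - y‖ / ‖x‖) + Hk (α - N) (‖x - y‖ / ‖x‖) =
        ‖x‖ ^ ((N : ℝ) - α) * ‖x - y‖ ^ (α - (N : ℝ)) := by
      have : (‖x - y‖ / ‖x‖) ^ (α - (N : ℝ)) = ‖x‖ ^ ((N : ℝ) - α) * ‖x - y‖ ^ (α - (N : ℝ)) := by
        rw [div_rpow (norm_nonneg _) hx.le, ← neg_sub (N : ℝ) α, rpow_neg hx.le, div_inv_eq_mul,
          mul_comm]
      rw [← this]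
      unfold Gk Hk
      split_ifs <;> simp
    simp only
    rw [← mul_add, hs]
    ring
  · exact (hgi.norm.mul_const _).mono' (hGm x) (Eventually.of_forall (hGb x))
  · refine ((hHx x hx).1.const_mul _).mono' ?_ (Eventually.of_forall (hBb x hx))
    exact hg.aestronglyMeasurable.mul (hHx x hx).1.aestronglyMeasurable

theorem Cna_nonneg (N : ℕ) (α : ℝ) (hα : α ∈ Set.Ioo (0 : ℝ) (N : ℝ)) : 0 ≤ Cna N α := by
  unfold Cna
  have h1 := Real.Gamma_pos_of_pos (show 0 < ((N : ℝ) - α) / 2 by linarith [hα.2])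
  have h2 := Real.Gamma_pos_of_pos (show 0 < α / 2 by linarith [hα.1])
  positivity

end Helpers

theorem riesz_asymptotic_bounds
    (N : ℕ) (hN : 2 ≤ N) (α θ C₀ : ℝ)
    (hα : α ∈ Set.Ioo (0 : ℝ) (N : ℝ)) (hθ : θ ∈ Set.Ioc (N : ℝ) ((N : ℝ) + α))
    (hC₀ : 0 < C₀)
    (u : En N → ℝ) (huL1 : Integrable u) (huc : Continuous u)
    (hurad : RadialDecreasing N (fun x => |u x|))
    (f F : ℝ → ℝ) (hf1 : Continuous f) (hF : ∀ t, F t = ∫ τ in (0 : ℝ)..t, f τ)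
    (hFbound : ∀ t : ℝ, |t| ≤ 1 → |F t| ≤ C₀ * |t| ^ (((N : ℝ) + α) / N)) :
    BddAbove (Set.range fun x : En N => |F (u x)| * (1 + ‖x‖ ^ θ)) ∧
    ∀ ε > (0 : ℝ), ∃ R > (0 : ℝ), ∀ x : En N, R ≤ ‖x‖ →
      (|rieszConv N α (fun y => F (u y)) x| ≤
          Cna N α * ‖x‖ ^ (α - (N : ℝ)) *
            (|∫ y, F (u y)| +
              ε * sSup (Set.range fun z : En N => |F (u z)| * (1 + ‖z‖ ^ θ))) ∧
        Cna N α * ‖x‖ ^ (α - (N : ℝ)) *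
            ((∫ y, F (u y)) -
              ε * sSup (Set.range fun z : En N => |F (u z)| * (1 + ‖z‖ ^ θ))) ≤
          rieszConv N α (fun y => F (u y)) x) := by
  have hFc : Continuous F := by
    have : F = fun t => ∫ τ in (0 : ℝ)..t, f τ := funext hF
    rw [this]
    exact intervalIntegral.continuous_primitive (fun a b => hf1.intervalIntegrable a b) 0
  have hbdd := bdd_aux N hN α θ C₀ hα hθ hC₀ u huL1 huc hurad F hFc hFbound
  refine ⟨hbdd, fun ε hε => ?_⟩
  set M := sSup (Set.range fun z : En N => |F (u z)| * (1 + ‖z‖ ^ θ)) with hMdef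
  have hM : ∀ y : En N, |F (u y)| * (1 + ‖y‖ ^ θ) ≤ M := fun y => le_csSup hbdd ⟨y, rfl⟩
  have hM0 : 0 ≤ M := le_trans (by positivity) (hM 0)
  rcases hM0.eq_or_lt with h0 | hMp
  · have hz : ∀ y, F (u y) = 0 := by
      intro y
      have h1 := hM y
      rw [← h0] at h1
      have h2 : 0 < 1 + ‖y‖ ^ θ := by positivity
      have h3 : |F (u y)| ≤ 0 := by
        by_contra hc
        push Not at hc
        linarith [mul_pos hc h2]
      exact abs_nonpos_iff.1 h3
    refine ⟨1, one_pos, fun x _ => ?_⟩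
    simp [rieszConv, hz, ← h0]
  · have ht := main_tendsto N hN α θ M hα hθ.1 (fun y => F (u y)) (hFc.comp huc) hM
    have hev := (Metric.tendsto_nhds.1 ht (ε * M) (by positivity))
    rw [eventually_comap] at hev
    obtain ⟨R, hR⟩ := eventually_atTop.1 hev
    refine ⟨max R 1, by positivity, fun x hx => ?_⟩
    have hd := hR ‖x‖ ((le_max_left _ _).trans hx) x rfl
    have hx0 : 0 < ‖x‖ := lt_of_lt_of_le one_pos ((le_max_right _ _).trans hx)
    have hC := Cna_nonneg N α hα
    set I := ∫ y, F (u y) * ‖x - y‖ ^ (α - (N : ℝ)) with hI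
    set G := ∫ y, F (u y) with hG
    set L := ‖x‖ ^ ((N : ℝ) - α) * I with hL
    rw [Real.dist_eq, abs_lt] at hd
    have hr : rieszConv N α (fun y => F (u y)) x = Cna N α * ‖x‖ ^ (α - (N : ℝ)) * L := by
      have e : ‖x‖ ^ (α - (N : ℝ)) * ‖x‖ ^ ((N : ℝ) - α) = 1 := by
        rw [← rpow_add hx0]; simp
      have : rieszConv N α (fun y => F (u y)) x = Cna N α * I := rfl
      rw [this, hL]
      linear_combination (-(Cna N α * I)) * e
    have hw : 0 ≤ Cna N α * ‖x‖ ^ (α - (N : ℝ)) := by positivity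
    rw [hr]
    constructor
    · rw [abs_mul, abs_of_nonneg hw]
      apply mul_le_mul_of_nonneg_left _ hw
      rw [abs_le]
      constructor
      · linarith [neg_abs_le G]
      · linarith [le_abs_self G]
    · apply mul_le_mul_of_nonneg_left _ hw
      linarith

end
end

section
/- For β > 0 set h_β(x) := (1+|x|²)^{−β/2} on ℝ^N, and let N ≥ 2, s ∈ (0,1). Then for every x ∈ ℝ^N the integral −(C_{N,s}/2) ∫_{ℝ^N} (h_{N−2s}(x+z)+h_{N−2s}(x−z)−2h_{N−2s}(x))/|z|^{N+2s} dz converges absolutely and equals 2^{2s} (Γ(N/2+s)/Γ(N/2−s)) · (1+|x|²)^{−(N+2s)/2}; that is, (−Δ)^s h_{N−2s} = 2^{2s} (Γ(N/2+s)/Γ(N/2−s)) h_{N+2s} pointwise. -/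
open MeasureTheory Real Filter

noncomputable section

/-- The fractional Laplacian constant `C_{N,s}`. -/
def Cns (N : ℕ) (s : ℝ) : ℝ :=
  4 ^ s * Real.Gamma (((N : ℝ) + 2 * s) / 2) /
    (Real.pi ^ ((N : ℝ) / 2) * |Real.Gamma (-s)|)

/-- The auxiliary function `h_β(x) = (1+|x|²)^{-β/2}`. -/
def hAux (N : ℕ) (β : ℝ) (x : En N) : ℝ := (1 + ‖x‖ ^ 2) ^ (-β / 2)

/-- Lebesgue measure on the positive half-line. -/
abbrev posM : Measure ℝ := volume.restrict (Set.Ioi (0 : ℝ))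

lemma posM_congr {f g : ℝ → ENNReal} (h : ∀ x, 0 < x → f x = g x) :
    ∫⁻ x, f x ∂posM = ∫⁻ x, g x ∂posM :=
  setLIntegral_congr_fun measurableSet_Ioi (fun x hx => h x hx)

/-- Gamma integral as a lintegral. -/
lemma gammaL {p c : ℝ} (hp : 0 < p) (hc : 0 < c) :
    ∫⁻ t, ENNReal.ofReal (t ^ (p - 1) * rexp (-(c * t))) ∂posM
      = ENNReal.ofReal (Real.Gamma p * c ^ (-p)) := by
  have h1 := Real.integral_rpow_mul_exp_neg_mul_Ioi hp hc
  have hpos : 0 < (1 / c) ^ p * Real.Gamma p :=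
    mul_pos (Real.rpow_pos_of_pos (by positivity) _) (Real.Gamma_pos_of_pos hp)
  have hint : Integrable (fun t : ℝ => t ^ (p - 1) * rexp (-(c * t))) posM := by
    by_contra hcon
    rw [integral_undef hcon] at h1
    linarith
  rw [← ofReal_integral_eq_lintegral_ofReal hint, h1]
  · congr 1
    rw [one_div, Real.inv_rpow hc.le, Real.rpow_neg hc.le, mul_comm]
  · filter_upwards [ae_restrict_mem measurableSet_Ioi] with t ht
    have : (0:ℝ) < t := ht
    simp only [Pi.zero_apply]
    positivity

lemma scaleL {c : ℝ} (hc : 0 < c) (f : ℝ → ENNReal) :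
    ∫⁻ x, f x ∂posM = ∫⁻ x, ENNReal.ofReal c * f (c * x) ∂posM := by
  have h := lintegral_image_eq_lintegral_abs_deriv_mul (s := Set.Ioi (0:ℝ))
    (f := fun x => c * x) (f' := fun _ => c) measurableSet_Ioi
    (fun x _ => by simpa using ((hasDerivAt_id x).const_mul c).hasDerivWithinAt)
    (fun x _ y _ hxy => mul_left_cancel₀ hc.ne' hxy) f
  have him : (fun x => c * x) '' Set.Ioi (0:ℝ) = Set.Ioi 0 := by
    ext y
    simp only [Set.mem_image, Set.mem_Ioi]
    constructor
    · rintro ⟨x, hx, rfl⟩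
      positivity
    · intro hy
      exact ⟨y / c, by positivity, by field_simp⟩
  rw [him, abs_of_pos hc] at h
  exact h

lemma invL {u : ℝ} (hu : 0 < u) (f : ℝ → ENNReal) :
    ∫⁻ x, f x ∂posM = ∫⁻ y, ENNReal.ofReal (u / y ^ 2) * f (u / y) ∂posM := by
  have h := lintegral_image_eq_lintegral_abs_deriv_mul (s := Set.Ioi (0:ℝ))
    (f := fun x => u / x) (f' := fun x => -(u / x ^ 2)) measurableSet_Ioi
    (fun x hx => by
      have hx' : (0:ℝ) < x := hx
      have := ((hasDerivAt_inv hx'.ne').const_mul u).hasDerivWithinAt (s := Set.Ioi 0)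
      refine this.congr_deriv ?_ |>.congr_of_eventuallyEq ?_ ?_
      · field_simp
      · exact Filter.Eventually.of_forall fun y => by simp [div_eq_mul_inv]
      · simp [div_eq_mul_inv])
    (fun x hx y hy hxy => by
      have hx' : (0:ℝ) < x := hx
      have hy' : (0:ℝ) < y := hy
      simp only at hxy
      field_simp at hxy
      exact hxy.symm) f
  have him : (fun x => u / x) '' Set.Ioi (0:ℝ) = Set.Ioi 0 := by
    ext y
    simp only [Set.mem_image, Set.mem_Ioi]
    constructor
    · rintro ⟨x, hx, rfl⟩
      positivity
    · intro hy
      exact ⟨u / y, by positivity, by field_simp⟩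
  rw [him] at h
  rw [h]
  refine posM_congr fun y hy => ?_
  rw [abs_neg, abs_of_pos (by positivity)]

lemma changeL (F : ℝ → ℝ → ENNReal) (hF : Measurable (Function.uncurry F)) :
    ∫⁻ t, ∫⁻ τ, F t τ ∂posM ∂posM =
      ∫⁻ u, ∫⁻ y, ENNReal.ofReal ((u + y) ^ 2 / y ^ 2) * F (u + y) ((u + y) * u / y) ∂posM ∂posM := by
  have hF' : ∀ {α : Type} [MeasurableSpace α] {f g : α → ℝ}, Measurable f → Measurable g →
      Measurable (fun p => F (f p) (g p)) := by
    intro α _ f g hf hg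
    exact hF.comp (hf.prodMk hg)
  calc ∫⁻ t, ∫⁻ τ, F t τ ∂posM ∂posM
      = ∫⁻ t, ∫⁻ v, ENNReal.ofReal t * F t (t * v) ∂posM ∂posM :=
        posM_congr fun t ht => scaleL ht _
    _ = ∫⁻ v, ∫⁻ t, ENNReal.ofReal t * F t (t * v) ∂posM ∂posM := by
        apply lintegral_lintegral_swap
        apply Measurable.aemeasurable
        unfold Function.uncurry
        exact (ENNReal.measurable_ofReal.comp measurable_fst).mul
          (hF' measurable_fst (measurable_fst.mul measurable_snd))
    _ = ∫⁻ v, ∫⁻ u, ENNReal.ofReal ((1 + v) / v) * (ENNReal.ofReal ((1 + v) / v * u) *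
          F ((1 + v) / v * u) ((1 + v) / v * u * v)) ∂posM ∂posM :=
        posM_congr fun v hv => scaleL (by positivity) _
    _ = ∫⁻ u, ∫⁻ v, ENNReal.ofReal ((1 + v) / v) * (ENNReal.ofReal ((1 + v) / v * u) *
          F ((1 + v) / v * u) ((1 + v) / v * u * v)) ∂posM ∂posM := by
        apply lintegral_lintegral_swap
        apply Measurable.aemeasurable
        unfold Function.uncurry
        refine Measurable.mul (by fun_prop) (Measurable.mul (by fun_prop) ?_)
        exact hF' (by fun_prop) (by fun_prop)
    _ = _ := by
        refine posM_congr fun u hu => ?_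
        rw [invL hu]
        refine posM_congr fun y hy => ?_
        have e1 : (1 + u / y) / (u / y) * u = u + y := by field_simp; ring
        have e2 : (u + y) * (u / y) = (u + y) * u / y := by ring
        rw [e1, e2, ← mul_assoc, ← mul_assoc, ← ENNReal.ofReal_mul (by positivity),
          ← ENNReal.ofReal_mul (by positivity)]
        congr 2
        field_simp
        ring

/-- The integral giving `|Γ(-s)|`. -/
lemma gammaNegL {s : ℝ} (hs : s ∈ Set.Ioo (0 : ℝ) 1) :
    ∫⁻ y, ENNReal.ofReal (y ^ (-s - 1) * (1 - rexp (-y))) ∂posM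
      = ENNReal.ofReal |Real.Gamma (-s)| := by
  obtain ⟨h0, h1⟩ := hs
  have key : ∀ y : ℝ, 0 < y → ENNReal.ofReal (y ^ (-s - 1) * (1 - rexp (-y)))
      = ∫⁻ θ in Set.Ioc (0:ℝ) 1, ENNReal.ofReal (y ^ ((1 - s) - 1) * rexp (-(θ * y))) := by
    intro y hy
    have hc : Continuous fun θ : ℝ => y ^ ((1 - s) - 1) * rexp (-(θ * y)) := by fun_prop
    rw [← ofReal_integral_eq_lintegral_ofReal]
    · congr 1
      rw [← intervalIntegral.integral_of_le zero_le_one]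
      have := intervalIntegral.integral_eq_sub_of_hasDerivAt (a := 0) (b := 1)
        (f := fun θ : ℝ => - (y ^ (-s - 1) * rexp (-(θ * y))))
        (f' := fun θ => y ^ ((1 - s) - 1) * rexp (-(θ * y)))
        (fun θ _ => by
          have h := ((((hasDerivAt_id θ).mul_const y).neg.exp).const_mul (y ^ (-s - 1))).neg
          refine h.congr_deriv ?_
          have : y ^ ((1 - s) - 1) = y ^ (-s - 1) * y := by
            rw [← Real.rpow_add_one hy.ne']; congr 1; ring
          rw [this]
          simp
          ring)
        (hc.intervalIntegrable _ _)
      rw [this]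
      simp
      ring
    · exact (hc.integrableOn_Icc).mono_set Set.Ioc_subset_Icc_self
    · exact Filter.Eventually.of_forall fun θ => by simp only [Pi.zero_apply]; positivity
  rw [posM_congr key, lintegral_lintegral_swap]
  · have e : ∀ θ ∈ Set.Ioc (0:ℝ) 1,
        ∫⁻ y, ENNReal.ofReal (y ^ ((1 - s) - 1) * rexp (-(θ * y))) ∂posM
          = ENNReal.ofReal (Real.Gamma (1 - s) * θ ^ (-(1 - s))) :=
      fun θ hθ => gammaL (by linarith) hθ.1
    rw [setLIntegral_congr_fun measurableSet_Ioc e]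
    have hg : 0 < Real.Gamma (1 - s) := Real.Gamma_pos_of_pos (by linarith)
    have hi : IntervalIntegrable (fun θ : ℝ => Real.Gamma (1 - s) * θ ^ (-(1 - s))) volume 0 1 :=
      (intervalIntegral.intervalIntegrable_rpow' (by linarith)).const_mul _
    rw [← ofReal_integral_eq_lintegral_ofReal]
    · congr 1
      rw [← intervalIntegral.integral_of_le zero_le_one, intervalIntegral.integral_const_mul,
        integral_rpow (Or.inl (by linarith))]
      have hG : Real.Gamma (1 - s) = -s * Real.Gamma (-s) := by
        rw [← Real.Gamma_add_one (by linarith)]; congr 1; ring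
      have hneg : Real.Gamma (-s) < 0 := by nlinarith
      rw [abs_of_neg hneg, hG, Real.zero_rpow (by linarith), Real.one_rpow]
      have : -(1 - s) + 1 = s := by ring
      rw [this]
      field_simp
      ring
    · exact (intervalIntegrable_iff_integrableOn_Ioc_of_le zero_le_one).1 hi
    · filter_upwards [ae_restrict_mem measurableSet_Ioc] with θ hθ
      have := hθ.1
      simp only [Pi.zero_apply]
      positivity
  · apply Measurable.aemeasurable
    unfold Function.uncurry
    fun_prop

lemma gauss0L (N : ℕ) {τ : ℝ} (hτ : 0 < τ) :
    ∫⁻ z : En N, ENNReal.ofReal (rexp (-(τ * ‖z‖ ^ 2)))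
      = ENNReal.ofReal ((π / τ) ^ ((N : ℝ) / 2)) := by
  have h := GaussianFourier.integral_rexp_neg_mul_sq_norm (V := En N) hτ
  simp only [finrank_euclideanSpace, Fintype.card_fin, neg_mul] at h
  have hpos : 0 < (π / τ) ^ ((N : ℝ) / 2) := by positivity
  rw [← ofReal_integral_eq_lintegral_ofReal, h]
  · by_contra hcon
    rw [integral_undef hcon] at h
    linarith
  · exact Filter.Eventually.of_forall fun θ => by simp only [Pi.zero_apply]; positivity

lemma gaussL (N : ℕ) (x : En N) {t τ : ℝ} (ht : 0 < t) (hτ : 0 < τ) :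
    ∫⁻ z : En N, ENNReal.ofReal (rexp (-(t * ‖x + z‖ ^ 2)) * rexp (-(τ * ‖z‖ ^ 2)))
      = ENNReal.ofReal ((π / (t + τ)) ^ ((N : ℝ) / 2) * rexp (-(t * τ / (t + τ) * ‖x‖ ^ 2))) := by
  have key : ∀ z : En N, rexp (-(t * ‖x + z‖ ^ 2)) * rexp (-(τ * ‖z‖ ^ 2)) =
      rexp (-((t + τ) * ‖z + (t / (t + τ)) • x‖ ^ 2)) * rexp (-(t * τ / (t + τ) * ‖x‖ ^ 2)) := by
    intro z
    rw [← Real.exp_add, ← Real.exp_add]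
    congr 1
    rw [norm_add_sq_real, norm_add_sq_real, inner_smul_right, norm_smul, real_inner_comm z x,
      mul_pow, Real.norm_eq_abs, sq_abs]
    field_simp
    ring
  simp_rw [key]
  have e : ∀ z : En N, ENNReal.ofReal (rexp (-((t + τ) * ‖z + (t / (t + τ)) • x‖ ^ 2)) *
      rexp (-(t * τ / (t + τ) * ‖x‖ ^ 2))) =
      ENNReal.ofReal (rexp (-((t + τ) * ‖z + (t / (t + τ)) • x‖ ^ 2))) *
      ENNReal.ofReal (rexp (-(t * τ / (t + τ) * ‖x‖ ^ 2))) := fun z =>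
    ENNReal.ofReal_mul (by positivity)
  simp_rw [e]
  rw [lintegral_mul_const _ (by fun_prop),
    lintegral_add_right_eq_self (fun z : En N => ENNReal.ofReal (rexp (-((t + τ) * ‖z‖ ^ 2)))),
    gauss0L N (by positivity), ← ENNReal.ofReal_mul (by positivity)]

lemma KL (N : ℕ) {s b δ : ℝ} (hs : 0 < s) (hb : b = (N : ℝ) / 2 + s) (hδ : 0 < δ) :
    ENNReal.ofReal (Real.Gamma b) * ∫⁻ z : En N, ENNReal.ofReal ((δ + ‖z‖ ^ 2) ^ (-b))
      = ENNReal.ofReal (π ^ ((N : ℝ) / 2) * (Real.Gamma s * δ ^ (-s))) := by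
  have hb0 : 0 < b := by rw [hb]; positivity
  have hG := Real.Gamma_pos_of_pos hb0
  rw [← lintegral_const_mul _ (by fun_prop)]
  have e1 : ∀ z : En N, ENNReal.ofReal (Real.Gamma b) * ENNReal.ofReal ((δ + ‖z‖ ^ 2) ^ (-b)) =
      ∫⁻ τ, ENNReal.ofReal (τ ^ (b - 1) * rexp (-((δ + ‖z‖ ^ 2) * τ))) ∂posM := fun z => by
    rw [gammaL hb0 (by positivity), ENNReal.ofReal_mul hG.le]
  simp_rw [e1]
  rw [lintegral_lintegral_swap]
  · have e2 : ∀ τ : ℝ, 0 < τ →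
        ∫⁻ z : En N, ENNReal.ofReal (τ ^ (b - 1) * rexp (-((δ + ‖z‖ ^ 2) * τ))) =
        ENNReal.ofReal (π ^ ((N : ℝ) / 2)) *
          ENNReal.ofReal (τ ^ (s - 1) * rexp (-(δ * τ))) := by
      intro τ hτ
      have : ∀ z : En N, ENNReal.ofReal (τ ^ (b - 1) * rexp (-((δ + ‖z‖ ^ 2) * τ))) =
          ENNReal.ofReal (τ ^ (b - 1) * rexp (-(δ * τ))) *
            ENNReal.ofReal (rexp (-(τ * ‖z‖ ^ 2))) := by
        intro z
        rw [← ENNReal.ofReal_mul (by positivity), mul_assoc, ← Real.exp_add]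
        congr 3
        ring_nf
      simp_rw [this]
      rw [lintegral_const_mul _ (by fun_prop), gauss0L N hτ, ← ENNReal.ofReal_mul (by positivity),
        ← ENNReal.ofReal_mul (by positivity)]
      congr 1
      rw [Real.div_rpow Real.pi_pos.le hτ.le]
      have : τ ^ (b - 1) = τ ^ (s - 1) * τ ^ ((N : ℝ) / 2) := by
        rw [← Real.rpow_add hτ, hb]; congr 1; ring
      rw [this]
      field_simp
    rw [posM_congr e2, lintegral_const_mul _ (by fun_prop), gammaL hs hδ,
      ← ENNReal.ofReal_mul (by positivity)]
  · apply Measurable.aemeasurable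
    unfold Function.uncurry
    fun_prop

lemma QL {s a b R δ : ℝ} (hs : 0 < s) (ha : 0 < a) (hab : b = a + 2 * s) (hδ : 0 < δ)
    (hR : 0 < R) :
    ∫⁻ u, ∫⁻ y, ENNReal.ofReal (u ^ (b - 1) * rexp (-(R * u)) * y ^ (-s - 1) *
      rexp (-(δ * (u + u ^ 2 / y)))) ∂posM ∂posM
      = ENNReal.ofReal (Real.Gamma s * δ ^ (-s) * (Real.Gamma a * (R + δ) ^ (-a))) := by
  have hG := Real.Gamma_pos_of_pos hs
  have e : ∀ u : ℝ, 0 < u → ∫⁻ y, ENNReal.ofReal (u ^ (b - 1) * rexp (-(R * u)) * y ^ (-s - 1) *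
      rexp (-(δ * (u + u ^ 2 / y)))) ∂posM =
      ENNReal.ofReal (Real.Gamma s * δ ^ (-s)) *
        ENNReal.ofReal (u ^ (a - 1) * rexp (-((R + δ) * u))) := by
    intro u hu
    rw [invL one_pos]
    have e2 : ∀ y : ℝ, 0 < y → ENNReal.ofReal (1 / y ^ 2) *
        ENNReal.ofReal (u ^ (b - 1) * rexp (-(R * u)) * (1 / y) ^ (-s - 1) *
          rexp (-(δ * (u + u ^ 2 / (1 / y))))) =
        ENNReal.ofReal (u ^ (b - 1) * rexp (-((R + δ) * u))) *
          ENNReal.ofReal (y ^ (s - 1) * rexp (-(δ * u ^ 2 * y))) := by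
      intro y hy
      rw [← ENNReal.ofReal_mul (by positivity), ← ENNReal.ofReal_mul (by positivity)]
      congr 1
      have h1 : (1 / y) ^ (-s - 1) = y ^ (s - 1) * y ^ 2 := by
        rw [one_div, Real.inv_rpow hy.le, ← Real.rpow_neg hy.le, ← Real.rpow_natCast y 2,
          ← Real.rpow_add hy]
        congr 1
        push_cast
        ring
      have h2 : rexp (-(R * u)) * rexp (-(δ * (u + u ^ 2 / (1 / y)))) =
          rexp (-((R + δ) * u)) * rexp (-(δ * u ^ 2 * y)) := by
        rw [← Real.exp_add, ← Real.exp_add]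
        congr 1
        field_simp
        ring
      rw [h1]
      calc _ = (y ^ 2 / y ^ 2) * u ^ (b - 1) * y ^ (s - 1) *
            (rexp (-(R * u)) * rexp (-(δ * (u + u ^ 2 / (1 / y))))) := by ring
        _ = _ := by
          rw [h2, div_self (by positivity)]
          ring
    rw [posM_congr e2, lintegral_const_mul _ (by fun_prop), gammaL hs (by positivity),
      ← ENNReal.ofReal_mul (by positivity), ← ENNReal.ofReal_mul (by positivity)]
    congr 1
    have h3 : (δ * u ^ 2) ^ (-s) = δ ^ (-s) * u ^ (-(2 * s)) := by
      rw [Real.mul_rpow hδ.le (by positivity), ← Real.rpow_natCast u 2, ← Real.rpow_mul hu.le]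
      congr 2
      push_cast
      ring
    have h4 : u ^ (a - 1) = u ^ (b - 1) * u ^ (-(2 * s)) := by
      rw [← Real.rpow_add hu]; congr 1; rw [hab]; ring
    rw [h3, h4]
    ring
  rw [posM_congr e, lintegral_const_mul _ (by fun_prop), gammaL ha (by positivity),
    ← ENNReal.ofReal_mul (by positivity)]

lemma star_identity (N : ℕ) (x : En N) {s a b δ : ℝ} (hs : 0 < s) (ha : 0 < a)
    (ha' : a = (N : ℝ) / 2 - s) (hb : b = (N : ℝ) / 2 + s) (hδ : 0 < δ) :
    ENNReal.ofReal (Real.Gamma a * Real.Gamma b) *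
      ∫⁻ z : En N, ENNReal.ofReal ((1 + ‖x + z‖ ^ 2) ^ (-a) * (δ + ‖z‖ ^ 2) ^ (-b))
    = ENNReal.ofReal (π ^ ((N : ℝ) / 2)) *
      ∫⁻ u, ∫⁻ y, ENNReal.ofReal (u ^ (b - 1) * rexp (-((1 + ‖x‖ ^ 2) * u)) * y ^ (-s - 1) *
        rexp (-(δ * (u + u ^ 2 / y))) * rexp (-y)) ∂posM ∂posM := by
  have hb0 : 0 < b := by rw [hb]; positivity
  have hGa := Real.Gamma_pos_of_pos ha
  have hGb := Real.Gamma_pos_of_pos hb0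
  rw [← lintegral_const_mul _ (by fun_prop)]
  have e1 : ∀ z : En N, ENNReal.ofReal (Real.Gamma a * Real.Gamma b) *
      ENNReal.ofReal ((1 + ‖x + z‖ ^ 2) ^ (-a) * (δ + ‖z‖ ^ 2) ^ (-b)) =
      ∫⁻ t, ∫⁻ τ, ENNReal.ofReal (t ^ (a - 1) * rexp (-((1 + ‖x + z‖ ^ 2) * t))) *
        ENNReal.ofReal (τ ^ (b - 1) * rexp (-((δ + ‖z‖ ^ 2) * τ))) ∂posM ∂posM := fun z => by
    have : ∀ t : ℝ, ∫⁻ τ, ENNReal.ofReal (t ^ (a - 1) * rexp (-((1 + ‖x + z‖ ^ 2) * t))) *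
        ENNReal.ofReal (τ ^ (b - 1) * rexp (-((δ + ‖z‖ ^ 2) * τ))) ∂posM =
        ENNReal.ofReal (t ^ (a - 1) * rexp (-((1 + ‖x + z‖ ^ 2) * t))) *
        ENNReal.ofReal (Real.Gamma b * (δ + ‖z‖ ^ 2) ^ (-b)) := fun t => by
      rw [lintegral_const_mul _ (by fun_prop), gammaL hb0 (by positivity)]
    simp_rw [this]
    rw [lintegral_mul_const _ (by fun_prop), gammaL ha (by positivity),
      ← ENNReal.ofReal_mul (by positivity), ← ENNReal.ofReal_mul (by positivity)]
    congr 1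
    ring
  simp_rw [e1]
  rw [lintegral_lintegral_swap]
  swap
  · apply Measurable.aemeasurable
    apply Measurable.lintegral_prod_right'
      (f := fun q : (En N × ℝ) × ℝ =>
        ENNReal.ofReal (q.1.2 ^ (a - 1) * rexp (-((1 + ‖x + q.1.1‖ ^ 2) * q.1.2))) *
        ENNReal.ofReal (q.2 ^ (b - 1) * rexp (-((δ + ‖q.1.1‖ ^ 2) * q.2))))
    fun_prop
  have e2 : ∀ t : ℝ, 0 < t → ∫⁻ z : En N, ∫⁻ τ,
        ENNReal.ofReal (t ^ (a - 1) * rexp (-((1 + ‖x + z‖ ^ 2) * t))) *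
        ENNReal.ofReal (τ ^ (b - 1) * rexp (-((δ + ‖z‖ ^ 2) * τ))) ∂posM =
      ∫⁻ τ, ENNReal.ofReal (t ^ (a - 1) * rexp (-t) * (τ ^ (b - 1) * rexp (-(δ * τ))) *
        ((π / (t + τ)) ^ ((N : ℝ) / 2) * rexp (-(t * τ / (t + τ) * ‖x‖ ^ 2)))) ∂posM := by
    intro t ht
    rw [lintegral_lintegral_swap]
    swap
    · apply Measurable.aemeasurable
      unfold Function.uncurry
      fun_prop
    refine posM_congr fun τ hτ => ?_
    have : ∀ z : En N, ENNReal.ofReal (t ^ (a - 1) * rexp (-((1 + ‖x + z‖ ^ 2) * t))) *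
        ENNReal.ofReal (τ ^ (b - 1) * rexp (-((δ + ‖z‖ ^ 2) * τ))) =
        ENNReal.ofReal (t ^ (a - 1) * rexp (-t) * (τ ^ (b - 1) * rexp (-(δ * τ)))) *
        ENNReal.ofReal (rexp (-(t * ‖x + z‖ ^ 2)) * rexp (-(τ * ‖z‖ ^ 2))) := by
      intro z
      rw [← ENNReal.ofReal_mul (by positivity), ← ENNReal.ofReal_mul (by positivity)]
      congr 1
      have h1 : rexp (-((1 + ‖x + z‖ ^ 2) * t)) = rexp (-t) * rexp (-(t * ‖x + z‖ ^ 2)) := by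
        rw [← Real.exp_add]; congr 1; ring
      have h2 : rexp (-((δ + ‖z‖ ^ 2) * τ)) = rexp (-(δ * τ)) * rexp (-(τ * ‖z‖ ^ 2)) := by
        rw [← Real.exp_add]; congr 1; ring
      rw [h1, h2]
      ring
    simp_rw [this]
    rw [lintegral_const_mul _ (by fun_prop), gaussL N x ht hτ, ← ENNReal.ofReal_mul (by positivity)]
  rw [posM_congr e2, changeL]
  swap
  · unfold Function.uncurry
    fun_prop
  rw [← lintegral_const_mul']
  swap
  · exact ENNReal.ofReal_ne_top
  refine posM_congr fun u hu => ?_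
  rw [← lintegral_const_mul' _ _ ENNReal.ofReal_ne_top]
  refine posM_congr fun y hy => ?_
  rw [← ENNReal.ofReal_mul (by positivity), ← ENNReal.ofReal_mul (by positivity)]
  congr 1
  have ht : 0 < u + y := by positivity
  have f1 : (u + y) + (u + y) * u / y = (u + y) ^ 2 / y := by field_simp; ring
  rw [f1]
  have f2 : (u + y) * ((u + y) * u / y) / ((u + y) ^ 2 / y) = u := by field_simp
  rw [f2]
  have f3 : (π / ((u + y) ^ 2 / y)) ^ ((N : ℝ) / 2) =
      π ^ ((N : ℝ) / 2) * (y ^ ((N : ℝ) / 2) * (u + y) ^ (-(N : ℝ))) := by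
    rw [Real.div_rpow Real.pi_pos.le (by positivity), Real.div_rpow (by positivity) hy.le,
      ← Real.rpow_natCast (u + y) 2, ← Real.rpow_mul ht.le, Real.rpow_neg ht.le]
    have : ((2 : ℕ) : ℝ) * ((N : ℝ) / 2) = N := by push_cast; ring
    rw [this]
    field_simp
  have f4 : ((u + y) * u / y) ^ (b - 1) = (u + y) ^ (b - 1) * u ^ (b - 1) * y ^ (1 - b) := by
    rw [Real.div_rpow (by positivity) hy.le, Real.mul_rpow ht.le hu.le,
      show 1 - b = -(b - 1) by ring, Real.rpow_neg hy.le]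
    field_simp
  have f5 : (u + y) ^ 2 / y ^ 2 = (u + y) ^ (2 : ℝ) * y ^ (-2 : ℝ) := by
    rw [Real.rpow_neg hy.le, Real.rpow_ofNat, Real.rpow_ofNat]
    field_simp
  have f6 : (u + y) ^ (2 : ℝ) * (u + y) ^ (a - 1) * (u + y) ^ (b - 1) * (u + y) ^ (-(N : ℝ)) = 1 := by
    rw [← Real.rpow_add ht, ← Real.rpow_add ht, ← Real.rpow_add ht,
      show (2 : ℝ) + (a - 1) + (b - 1) + -(N : ℝ) = 0 by rw [ha', hb]; ring, Real.rpow_zero]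
  have f7 : y ^ (-2 : ℝ) * y ^ (1 - b) * y ^ ((N : ℝ) / 2) = y ^ (-s - 1) := by
    rw [← Real.rpow_add hy, ← Real.rpow_add hy]
    congr 1
    rw [hb]; ring
  have f8 : rexp (-(u + y)) * rexp (-(δ * ((u + y) * u / y))) * rexp (-(u * ‖x‖ ^ 2)) =
      rexp (-((1 + ‖x‖ ^ 2) * u)) * rexp (-(δ * (u + u ^ 2 / y))) * rexp (-y) := by
    rw [← Real.exp_add, ← Real.exp_add, ← Real.exp_add, ← Real.exp_add]
    congr 1
    field_simp
    ring
  rw [f3, f4, f5]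
  calc _ = ((u + y) ^ (2 : ℝ) * (u + y) ^ (a - 1) * (u + y) ^ (b - 1) * (u + y) ^ (-(N : ℝ))) *
        (y ^ (-2 : ℝ) * y ^ (1 - b) * y ^ ((N : ℝ) / 2)) * π ^ ((N : ℝ) / 2) * u ^ (b - 1) *
        (rexp (-(u + y)) * rexp (-(δ * ((u + y) * u / y))) * rexp (-(u * ‖x‖ ^ 2))) := by ring
    _ = _ := by rw [f6, f7, f8]; ring

lemma Wlim {s b R : ℝ} (hs : s ∈ Set.Ioo (0 : ℝ) 1) (hb : 0 < b) (hR : 0 < R) :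
    Tendsto (fun δ : ℝ => ∫⁻ p : ℝ × ℝ, ENNReal.ofReal (p.1 ^ (b - 1) * rexp (-(R * p.1)) *
      p.2 ^ (-s - 1) * rexp (-(δ * (p.1 + p.1 ^ 2 / p.2))) * (1 - rexp (-p.2))) ∂(posM.prod posM))
      (nhdsWithin 0 (Set.Ioi 0))
      (nhds (ENNReal.ofReal (Real.Gamma b * R ^ (-b) * |Real.Gamma (-s)|))) := by
  have hG := Real.Gamma_pos_of_pos hb
  have hval : ∫⁻ p : ℝ × ℝ, ENNReal.ofReal (p.1 ^ (b - 1) * rexp (-(R * p.1)) *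
      p.2 ^ (-s - 1) * (1 - rexp (-p.2))) ∂(posM.prod posM) =
      ENNReal.ofReal (Real.Gamma b * R ^ (-b) * |Real.Gamma (-s)|) := by
    rw [lintegral_prod _ (by fun_prop)]
    have e : ∀ u : ℝ, 0 < u → ∫⁻ y, ENNReal.ofReal (u ^ (b - 1) * rexp (-(R * u)) *
        y ^ (-s - 1) * (1 - rexp (-y))) ∂posM = ENNReal.ofReal (u ^ (b - 1) * rexp (-(R * u))) *
        ENNReal.ofReal |Real.Gamma (-s)| := by
      intro u hu
      rw [← gammaNegL hs, ← lintegral_const_mul _ (by fun_prop)]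
      refine posM_congr fun y hy => ?_
      rw [← ENNReal.ofReal_mul (by positivity), mul_assoc]
    rw [posM_congr e, lintegral_mul_const _ (by fun_prop), gammaL hb hR,
      ← ENNReal.ofReal_mul (by positivity)]
  have hae : ∀ᵐ p : ℝ × ℝ ∂(posM.prod posM), 0 < p.1 ∧ 0 < p.2 := by
    rw [Measure.prod_restrict]
    filter_upwards [ae_restrict_mem (measurableSet_Ioi.prod measurableSet_Ioi)] with p hp
    exact hp
  rw [← hval]
  refine tendsto_lintegral_filter_of_dominated_convergence (fun p : ℝ × ℝ =>
    ENNReal.ofReal (p.1 ^ (b - 1) * rexp (-(R * p.1)) *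
      p.2 ^ (-s - 1) * (1 - rexp (-p.2)))) ?_ ?_ ?_ ?_
  · exact Filter.Eventually.of_forall fun δ => by fun_prop
  · filter_upwards [self_mem_nhdsWithin] with δ hδ
    filter_upwards [hae] with p hp
    obtain ⟨h1, h2⟩ := hp
    have hδ' : (0:ℝ) < δ := hδ
    apply ENNReal.ofReal_le_ofReal
    have hx : 0 ≤ 1 - rexp (-p.2) := by
      have : rexp (-p.2) ≤ 1 := Real.exp_le_one_iff.2 (by linarith)
      linarith
    apply mul_le_mul_of_nonneg_right _ hx
    have : rexp (-(δ * (p.1 + p.1 ^ 2 / p.2))) ≤ 1 := by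
      apply Real.exp_le_one_iff.2
      have : 0 ≤ δ * (p.1 + p.1 ^ 2 / p.2) := by positivity
      linarith
    exact mul_le_of_le_one_right (by positivity) this
  · rw [hval]; exact ENNReal.ofReal_ne_top
  · filter_upwards with p
    apply ENNReal.tendsto_ofReal
    have hc : Continuous fun δ : ℝ => p.1 ^ (b - 1) * rexp (-(R * p.1)) *
      p.2 ^ (-s - 1) * rexp (-(δ * (p.1 + p.1 ^ 2 / p.2))) * (1 - rexp (-p.2)) := by fun_prop
    have := (hc.tendsto 0).mono_left (nhdsWithin_le_nhds (s := Set.Ioi 0))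
    simpa using this

lemma PWQ (s b R δ : ℝ) :
    ∫⁻ u, ∫⁻ y, ENNReal.ofReal (u ^ (b - 1) * rexp (-(R * u)) * y ^ (-s - 1) *
        rexp (-(δ * (u + u ^ 2 / y))) * rexp (-y)) ∂posM ∂posM +
    ∫⁻ p : ℝ × ℝ, ENNReal.ofReal (p.1 ^ (b - 1) * rexp (-(R * p.1)) *
      p.2 ^ (-s - 1) * rexp (-(δ * (p.1 + p.1 ^ 2 / p.2))) * (1 - rexp (-p.2))) ∂(posM.prod posM)
    = ∫⁻ u, ∫⁻ y, ENNReal.ofReal (u ^ (b - 1) * rexp (-(R * u)) * y ^ (-s - 1) *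
      rexp (-(δ * (u + u ^ 2 / y)))) ∂posM ∂posM := by
  rw [lintegral_prod _ (by fun_prop), ← lintegral_add_left]
  swap
  · apply Measurable.lintegral_prod_right' (f := fun q : ℝ × ℝ =>
      ENNReal.ofReal (q.1 ^ (b - 1) * rexp (-(R * q.1)) * q.2 ^ (-s - 1) *
        rexp (-(δ * (q.1 + q.1 ^ 2 / q.2))) * rexp (-q.2)))
    fun_prop
  refine posM_congr fun u hu => ?_
  rw [← lintegral_add_left (by fun_prop)]
  refine posM_congr fun y hy => ?_
  have hx : 0 ≤ 1 - rexp (-y) := by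
    have : rexp (-y) ≤ 1 := Real.exp_le_one_iff.2 (by linarith)
    linarith
  rw [← ENNReal.ofReal_add (by positivity) (by positivity)]
  congr 1
  ring

/-- Lipschitz bound for `q ↦ q^{-a}` on `[1,∞)`. -/
lemma lip_rpow {a : ℝ} (ha : 0 < a) {p q : ℝ} (hp : 1 ≤ p) (hq : 1 ≤ q) :
    |q ^ (-a) - p ^ (-a)| ≤ a * |q - p| := by
  have h := Convex.norm_image_sub_le_of_norm_hasDerivWithin_le (s := Set.Ici (1:ℝ))
    (f := fun x : ℝ => x ^ (-a)) (f' := fun x => -a * x ^ (-a - 1)) (C := a) (x := p) (y := q)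
    (fun x hx => by
      have hx' : (1:ℝ) ≤ x := hx
      exact (Real.hasDerivAt_rpow_const (Or.inl (by linarith))).hasDerivWithinAt)
    (fun x hx => by
      have hx' : (1:ℝ) ≤ x := hx
      have h1 : x ^ (-a - 1) ≤ 1 := Real.rpow_le_one_of_one_le_of_nonpos hx' (by linarith)
      have h2 : 0 ≤ x ^ (-a - 1) := by positivity
      rw [Real.norm_eq_abs, abs_mul, abs_neg, abs_of_pos ha, abs_of_nonneg h2]
      nlinarith)
    (convex_Ici 1) hp hq
  simpa [Real.norm_eq_abs] using h

/-- Second-order Taylor bound for `q ↦ q^{-a}` on `[1,∞)`. -/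
lemma taylor_rpow {a : ℝ} (ha : 0 < a) {p q : ℝ} (hp : 1 ≤ p) (hq : 1 ≤ q) :
    |q ^ (-a) - p ^ (-a) + a * p ^ (-a - 1) * (q - p)| ≤ a * (a + 1) * (q - p) ^ 2 := by
  have hsub : ∀ x ∈ Set.uIcc p q, 1 ≤ x := by
    intro x hx
    have := hx.1
    exact le_trans (le_inf hp hq) this
  have h := Convex.norm_image_sub_le_of_norm_hasDerivWithin_le (s := Set.uIcc p q)
    (f := fun x : ℝ => x ^ (-a) + a * p ^ (-a - 1) * x)
    (f' := fun x => -a * x ^ (-a - 1) + a * p ^ (-a - 1))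
    (C := a * (a + 1) * |q - p|) (x := p) (y := q)
    (fun x hx => by
      have hx' := hsub x hx
      have h1 := (Real.hasDerivAt_rpow_const (x := x) (p := -a) (Or.inl (by linarith)))
      have h2 := (hasDerivAt_id x).const_mul (a * p ^ (-a - 1))
      refine ((h1.add h2).congr_deriv ?_).hasDerivWithinAt
      simp)
    (fun x hx => by
      have hx' := hsub x hx
      have h1 := lip_rpow (a := a + 1) (by linarith) hp hx'
      have h2 : |x - p| ≤ |q - p| := Set.abs_sub_left_of_mem_uIcc hx
      have e : -a * x ^ (-a - 1) + a * p ^ (-a - 1) =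
          -a * (x ^ (-(a + 1)) - p ^ (-(a + 1))) := by
        rw [show -(a + 1) = -a - 1 by ring]; ring
      rw [e, Real.norm_eq_abs, abs_mul, abs_neg, abs_of_pos ha, mul_assoc]
      apply mul_le_mul_of_nonneg_left _ ha.le
      refine h1.trans ?_
      gcongr)
    (convex_uIcc p q) Set.left_mem_uIcc Set.right_mem_uIcc
  rw [Real.norm_eq_abs, Real.norm_eq_abs, mul_assoc (a * (a + 1)), ← sq, sq_abs] at h
  refine le_trans (le_of_eq ?_) h
  congr 1
  ring

lemma second_diff {N : ℕ} {a : ℝ} (ha : 0 < a) (x : En N) :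
    ∃ C : ℝ, 0 ≤ C ∧ ∀ z : En N, ‖z‖ ≤ 1 →
      |(1 + ‖x + z‖ ^ 2) ^ (-a) + (1 + ‖x - z‖ ^ 2) ^ (-a) - 2 * (1 + ‖x‖ ^ 2) ^ (-a)|
        ≤ C * ‖z‖ ^ 2 := by
  refine ⟨a * (a + 1) * (2 + 8 * ‖x‖ ^ 2) + 2 * a, by positivity, fun z hz => ?_⟩
  have h0 : (1:ℝ) ≤ 1 + ‖x‖ ^ 2 := by nlinarith [sq_nonneg ‖x‖]
  have h1 : (1:ℝ) ≤ 1 + ‖x + z‖ ^ 2 := by nlinarith [sq_nonneg ‖x + z‖]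
  have h2 : (1:ℝ) ≤ 1 + ‖x - z‖ ^ 2 := by nlinarith [sq_nonneg ‖x - z‖]
  have t1 := taylor_rpow ha h0 h1
  have t2 := taylor_rpow ha h0 h2
  have hm := abs_real_inner_le_norm x z
  have e1 : ‖x + z‖ ^ 2 = ‖x‖ ^ 2 + 2 * inner ℝ x z + ‖z‖ ^ 2 := norm_add_sq_real x z
  have e2 : ‖x - z‖ ^ 2 = ‖x‖ ^ 2 - 2 * inner ℝ x z + ‖z‖ ^ 2 := norm_sub_sq_real x z
  set m : ℝ := inner ℝ x z
  have hm2 : m ^ 2 ≤ ‖x‖ ^ 2 * ‖z‖ ^ 2 := by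
    rw [← mul_pow, ← sq_abs m]
    gcongr
  have hp : (1 + ‖x‖ ^ 2) ^ (-a - 1) ≤ 1 :=
    Real.rpow_le_one_of_one_le_of_nonpos h0 (by linarith)
  have hp0 : 0 ≤ (1 + ‖x‖ ^ 2) ^ (-a - 1) := by positivity
  have s1 : (1 + ‖x + z‖ ^ 2 - (1 + ‖x‖ ^ 2)) = 2 * m + ‖z‖ ^ 2 := by rw [e1]; ring
  have s2 : (1 + ‖x - z‖ ^ 2 - (1 + ‖x‖ ^ 2)) = -2 * m + ‖z‖ ^ 2 := by rw [e2]; ring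
  rw [s1] at t1
  rw [s2] at t2
  set A := (1 + ‖x + z‖ ^ 2) ^ (-a)
  set B := (1 + ‖x - z‖ ^ 2) ^ (-a)
  set D := (1 + ‖x‖ ^ 2) ^ (-a)
  set P := (1 + ‖x‖ ^ 2) ^ (-a - 1)
  have hz4 : (‖z‖ ^ 2) ^ 2 ≤ ‖z‖ ^ 2 := by
    have : ‖z‖ ^ 2 ≤ 1 := by nlinarith [norm_nonneg z]
    nlinarith [sq_nonneg ‖z‖]
  have haa : 0 ≤ a * (a + 1) := by positivity
  have b1 : a * (a + 1) * (2 * m + ‖z‖ ^ 2) ^ 2 + a * (a + 1) * (-2 * m + ‖z‖ ^ 2) ^ 2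
      ≤ a * (a + 1) * ((2 + 8 * ‖x‖ ^ 2) * ‖z‖ ^ 2) := by
    rw [← mul_add]
    apply mul_le_mul_of_nonneg_left _ haa
    nlinarith
  have b2 : 2 * a * P * ‖z‖ ^ 2 ≤ 2 * a * ‖z‖ ^ 2 := by
    apply mul_le_mul_of_nonneg_right _ (by positivity)
    nlinarith
  have b3 : 0 ≤ 2 * a * P * ‖z‖ ^ 2 := by positivity
  have c1 := abs_le.1 t1
  have c2 := abs_le.1 t2
  rw [abs_le]
  constructor <;> nlinarith [c1.1, c1.2, c2.1, c2.2]

lemma int_main {N : ℕ} (hN : 2 ≤ N) {s a : ℝ} (hs : s ∈ Set.Ioo (0 : ℝ) 1) (ha : 0 < a)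
    (x : En N) :
    Integrable (fun z : En N =>
      ((1 + ‖x + z‖ ^ 2) ^ (-a) + (1 + ‖x - z‖ ^ 2) ^ (-a) - 2 * (1 + ‖x‖ ^ 2) ^ (-a)) /
        ‖z‖ ^ ((N : ℝ) + 2 * s)) := by
  obtain ⟨h0, h1⟩ := hs
  obtain ⟨C, hC, hb⟩ := second_diff ha x
  have : Nontrivial (En N) := by
    have : Nonempty (Fin N) := ⟨⟨0, by omega⟩⟩
    infer_instance
  have hdim : (((N - 1 : ℕ) : ℝ)) = (N : ℝ) - 1 := by
    rw [Nat.cast_sub (by omega)]; simp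
  have hI : Integrable (fun z : En N => (fun y : ℝ =>
      if y ≤ 1 then C * y ^ 2 / y ^ ((N : ℝ) + 2 * s) else 4 / y ^ ((N : ℝ) + 2 * s)) ‖z‖) := by
    refine (integrable_fun_norm_addHaar (E := En N) volume (f := fun y : ℝ =>
      if y ≤ 1 then C * y ^ 2 / y ^ ((N : ℝ) + 2 * s) else 4 / y ^ ((N : ℝ) + 2 * s))).2 ?_
    rw [← Set.Ioc_union_Ioi_eq_Ioi (zero_le_one' ℝ)]
    simp only [finrank_euclideanSpace, Fintype.card_fin, smul_eq_mul]
    apply IntegrableOn.union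
    · have : IntegrableOn (fun y : ℝ => C * y ^ (1 - 2 * s)) (Set.Ioc 0 1) := by
        have := (intervalIntegral.intervalIntegrable_rpow' (a := 0) (b := 1)
          (r := 1 - 2 * s) (by linarith)).const_mul C
        exact (intervalIntegrable_iff_integrableOn_Ioc_of_le zero_le_one).1 this
      refine this.congr_fun (fun y hy => ?_) measurableSet_Ioc
      have hy0 := hy.1
      simp only [hy.2, if_true]
      rw [← Real.rpow_natCast y (N - 1), hdim, ← Real.rpow_natCast y 2, mul_div_assoc,
        ← Real.rpow_sub hy0, mul_left_comm, ← Real.rpow_add hy0]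
      congr 2
      push_cast
      ring
    · have : IntegrableOn (fun y : ℝ => 4 * y ^ (-1 - 2 * s)) (Set.Ioi 1) :=
        (integrableOn_Ioi_rpow_of_lt (by linarith) one_pos).const_mul 4
      refine this.congr_fun (fun y hy => ?_) measurableSet_Ioi
      have hy1 : 1 < y := hy
      have hy0 : 0 < y := by linarith
      simp only [not_le.2 hy1, if_false]
      rw [← Real.rpow_natCast y (N - 1), hdim, div_eq_mul_inv, ← Real.rpow_neg hy0.le,
        mul_left_comm, ← Real.rpow_add hy0]
      congr 2
      ring
  refine hI.mono' ?_ ?_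
  · apply Measurable.aestronglyMeasurable
    fun_prop
  · filter_upwards with z
    have hz : 0 ≤ ‖z‖ ^ ((N : ℝ) + 2 * s) := by positivity
    rw [Real.norm_eq_abs, abs_div, abs_of_nonneg hz]
    split_ifs with h
    · exact div_le_div_of_nonneg_right (hb z h) hz
    · apply div_le_div_of_nonneg_right _ hz
      have k : ∀ w : En N, 0 ≤ (1 + ‖w‖ ^ 2) ^ (-a) ∧ (1 + ‖w‖ ^ 2) ^ (-a) ≤ 1 := fun w =>
        ⟨by positivity, Real.rpow_le_one_of_one_le_of_nonpos
          (by nlinarith [sq_nonneg ‖w‖]) (by linarith)⟩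
      have k1 := k (x + z)
      have k2 := k (x - z)
      have k3 := k x
      rw [abs_le]
      constructor <;> linarith [k1.1, k1.2, k2.1, k2.2, k3.1, k3.2]

lemma toReal_identities {N : ℕ} {s a b δ : ℝ} (hs : 0 < s) (ha : 0 < a)
    (ha' : a = (N : ℝ) / 2 - s) (hb : b = (N : ℝ) / 2 + s) (hδ : 0 < δ) (x : En N) :
    Integrable (fun z : En N => (δ + ‖z‖ ^ 2) ^ (-b)) ∧
    Real.Gamma b * ∫ z : En N, (δ + ‖z‖ ^ 2) ^ (-b) =
      π ^ ((N : ℝ) / 2) * (Real.Gamma s * δ ^ (-s)) ∧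
    Real.Gamma a * Real.Gamma b *
      ∫ z : En N, (1 + ‖x + z‖ ^ 2) ^ (-a) * (δ + ‖z‖ ^ 2) ^ (-b) =
      π ^ ((N : ℝ) / 2) * (Real.Gamma s * δ ^ (-s) *
        (Real.Gamma a * (1 + ‖x‖ ^ 2 + δ) ^ (-a)) -
        (∫⁻ p : ℝ × ℝ, ENNReal.ofReal (p.1 ^ (b - 1) * rexp (-((1 + ‖x‖ ^ 2) * p.1)) *
          p.2 ^ (-s - 1) * rexp (-(δ * (p.1 + p.1 ^ 2 / p.2))) *
            (1 - rexp (-p.2))) ∂(posM.prod posM)).toReal) := by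
  have hb0 : 0 < b := by rw [hb]; positivity
  have hGa := Real.Gamma_pos_of_pos ha
  have hGb := Real.Gamma_pos_of_pos hb0
  have hGs := Real.Gamma_pos_of_pos hs
  have hK := KL N hs hb hδ
  have hS := star_identity N x hs ha ha' hb hδ
  have hQ := QL (R := 1 + ‖x‖ ^ 2) hs ha (by rw [ha', hb]; ring : b = a + 2 * s) hδ (by positivity)
  have hP := PWQ s b (1 + ‖x‖ ^ 2) δ
  rw [hQ] at hP
  refine ⟨?_, ?_, ?_⟩
  · refine ⟨Measurable.aestronglyMeasurable (by fun_prop), ?_⟩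
    rw [hasFiniteIntegral_iff_ofReal
      (Filter.Eventually.of_forall fun z => by simp only [Pi.zero_apply]; positivity)]
    by_contra hcon
    rw [not_lt, top_le_iff] at hcon
    rw [hcon, ENNReal.mul_top (by simpa using hGb)] at hK
    exact ENNReal.ofReal_ne_top hK.symm
  · rw [integral_eq_lintegral_of_nonneg_ae
      (Filter.Eventually.of_forall fun z => by simp only [Pi.zero_apply]; positivity)
      (Measurable.aestronglyMeasurable (by fun_prop))]
    have := congrArg ENNReal.toReal hK
    rw [ENNReal.toReal_mul, ENNReal.toReal_ofReal hGb.le,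
      ENNReal.toReal_ofReal (by positivity)] at this
    exact this
  · rw [integral_eq_lintegral_of_nonneg_ae
      (Filter.Eventually.of_forall fun z => by simp only [Pi.zero_apply]; positivity)
      (Measurable.aestronglyMeasurable (by fun_prop))]
    have h1 := congrArg ENNReal.toReal hS
    rw [ENNReal.toReal_mul, ENNReal.toReal_mul, ENNReal.toReal_ofReal (by positivity),
      ENNReal.toReal_ofReal (by positivity)] at h1
    rw [h1]
    congr 1
    have hne := hP.trans_ne ENNReal.ofReal_ne_top
    rw [ENNReal.add_ne_top] at hne
    have h2 := congrArg ENNReal.toReal hP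
    rw [ENNReal.toReal_add hne.1 hne.2, ENNReal.toReal_ofReal (by positivity)] at h2
    linarith

lemma err_lim {s a R : ℝ} (hs : s < 1) (ha : 0 < a) (hR : 1 ≤ R) :
    Tendsto (fun δ : ℝ => δ ^ (-s) * (R ^ (-a) - (R + δ) ^ (-a)))
      (nhdsWithin 0 (Set.Ioi 0)) (nhds 0) := by
  have hlim : Tendsto (fun δ : ℝ => a * δ ^ (1 - s)) (nhdsWithin 0 (Set.Ioi 0)) (nhds 0) := by
    have hc : ContinuousAt (fun δ : ℝ => a * δ ^ (1 - s)) 0 :=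
      (Real.continuousAt_rpow_const 0 (1 - s) (Or.inr (by linarith))).const_mul a
    have := hc.tendsto.mono_left (nhdsWithin_le_nhds (s := Set.Ioi 0))
    simpa [Real.zero_rpow (by linarith : (1 - s) ≠ 0)] using this
  refine squeeze_zero_norm' ?_ hlim
  filter_upwards [self_mem_nhdsWithin] with δ hδ
  have hδ' : (0:ℝ) < δ := hδ
  have h := lip_rpow ha (p := R + δ) (q := R) (by linarith) hR
  have e : |R - (R + δ)| = δ := by
    rw [show R - (R + δ) = -δ by ring, abs_neg, abs_of_pos hδ']
  rw [e] at h
  rw [Real.norm_eq_abs, abs_mul, abs_of_pos (by positivity : (0:ℝ) < δ ^ (-s))]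
  calc _ ≤ δ ^ (-s) * (a * δ) := by gcongr
    _ = a * (δ ^ (-s) * δ) := by ring
    _ = a * δ ^ (1 - s) := by
      rw [← Real.rpow_add_one hδ'.ne']; congr 2; ring

lemma core {N : ℕ} (hN : 2 ≤ N) {s a b : ℝ} (hs : s ∈ Set.Ioo (0 : ℝ) 1)
    (ha : 0 < a) (ha' : a = (N : ℝ) / 2 - s) (hb : b = (N : ℝ) / 2 + s) (x : En N) :
    ∫ z : En N,
      ((1 + ‖x + z‖ ^ 2) ^ (-a) + (1 + ‖x - z‖ ^ 2) ^ (-a) - 2 * (1 + ‖x‖ ^ 2) ^ (-a)) /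
        ‖z‖ ^ ((N : ℝ) + 2 * s) =
    -(2 * π ^ ((N : ℝ) / 2) / Real.Gamma a * ((1 + ‖x‖ ^ 2) ^ (-b) * |Real.Gamma (-s)|)) := by
  have hb0 : 0 < b := by rw [hb]; have := hs.1; positivity
  have hGa := Real.Gamma_pos_of_pos ha
  have hGb := Real.Gamma_pos_of_pos hb0
  have hint := int_main hN hs ha x
  have hR : (1:ℝ) ≤ 1 + ‖x‖ ^ 2 := by nlinarith [sq_nonneg ‖x‖]
  set G : En N → ℝ := fun z =>
    (1 + ‖x + z‖ ^ 2) ^ (-a) + (1 + ‖x - z‖ ^ 2) ^ (-a) - 2 * (1 + ‖x‖ ^ 2) ^ (-a) with hG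
  have hGm : Measurable G := by rw [hG]; fun_prop
  -- first limit
  have L1 : Tendsto (fun δ : ℝ => ∫ z : En N, G z * (δ + ‖z‖ ^ 2) ^ (-b))
      (nhdsWithin 0 (Set.Ioi 0)) (nhds (∫ z : En N, G z / ‖z‖ ^ ((N : ℝ) + 2 * s))) := by
    have hnz : ∀ z : En N, G z / ‖z‖ ^ ((N : ℝ) + 2 * s) = G z * (‖z‖ ^ 2) ^ (-b) := by
      intro z
      rw [← Real.rpow_natCast ‖z‖ 2, ← Real.rpow_mul (norm_nonneg z), div_eq_mul_inv,
        ← Real.rpow_neg (norm_nonneg z)]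
      congr 2
      rw [hb]; push_cast; ring
    have hae : ∀ᵐ z : En N, z ≠ 0 := by
      have : Nonempty (Fin N) := ⟨⟨0, by omega⟩⟩
      have : Nontrivial (En N) := inferInstance
      exact Measure.ae_ne volume 0
    refine tendsto_integral_filter_of_dominated_convergence
      (fun z => ‖G z / ‖z‖ ^ ((N : ℝ) + 2 * s)‖) ?_ ?_ hint.norm ?_
    · exact Filter.Eventually.of_forall fun δ =>
        (hGm.mul (by fun_prop)).aestronglyMeasurable
    · filter_upwards [self_mem_nhdsWithin] with δ hδ
      have hδ' : (0:ℝ) < δ := hδ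
      filter_upwards [hae] with z hz
      have hz' : 0 < ‖z‖ ^ 2 := by have := norm_pos_iff.2 hz; positivity
      rw [hnz, norm_mul, norm_mul]
      apply mul_le_mul_of_nonneg_left _ (norm_nonneg _)
      rw [Real.norm_of_nonneg (by positivity), Real.norm_of_nonneg (by positivity)]
      exact Real.rpow_le_rpow_of_nonpos hz' (by linarith) (by linarith)
    · filter_upwards [hae] with z hz
      have hz' : 0 < ‖z‖ ^ 2 := by have := norm_pos_iff.2 hz; positivity
      rw [hnz]
      apply Tendsto.const_mul
      have hc : ContinuousAt (fun δ : ℝ => (δ + ‖z‖ ^ 2) ^ (-b)) 0 := by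
        apply ContinuousAt.rpow_const (by fun_prop)
        left
        simpa using hz
      have := hc.tendsto.mono_left (nhdsWithin_le_nhds (s := Set.Ioi 0))
      simpa using this
  -- second limit
  have W := (ENNReal.tendsto_toReal ENNReal.ofReal_ne_top).comp
    (Wlim (b := b) (R := 1 + ‖x‖ ^ 2) hs hb0 (by positivity))
  rw [ENNReal.toReal_ofReal (by positivity)] at W
  have E := err_lim hs.2 ha hR
  have L2 := ((E.const_mul (Real.Gamma s * Real.Gamma a)).add W).const_mul
    (-(2 * π ^ ((N : ℝ) / 2) / (Real.Gamma a * Real.Gamma b)))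
  have L3 : Tendsto (fun δ : ℝ => ∫ z : En N, G z * (δ + ‖z‖ ^ 2) ^ (-b))
      (nhdsWithin 0 (Set.Ioi 0)) (nhds (-(2 * π ^ ((N : ℝ) / 2) / (Real.Gamma a * Real.Gamma b)) *
        (Real.Gamma s * Real.Gamma a * 0 +
          Real.Gamma b * (1 + ‖x‖ ^ 2) ^ (-b) * |Real.Gamma (-s)|))) := by
    refine L2.congr' ?_
    filter_upwards [self_mem_nhdsWithin] with δ hδ
    have hδ' : (0:ℝ) < δ := hδ
    obtain ⟨i1, i2, i3⟩ := toReal_identities hs.1 ha ha' hb hδ' x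
    have hI : ∀ y : En N, Integrable (fun z : En N => (1 + ‖z + y‖ ^ 2) ^ (-a) * (δ + ‖z‖ ^ 2) ^ (-b)) := by
      intro y
      refine i1.mono' (Measurable.aestronglyMeasurable (by fun_prop)) ?_
      filter_upwards with z
      rw [Real.norm_of_nonneg (by positivity)]
      apply mul_le_of_le_one_left (by positivity)
      exact Real.rpow_le_one_of_one_le_of_nonpos
          (by nlinarith [sq_nonneg ‖z + y‖]) (by linarith)
    have hI1 : Integrable (fun z : En N => (1 + ‖x + z‖ ^ 2) ^ (-a) * (δ + ‖z‖ ^ 2) ^ (-b)) := by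
      simpa only [add_comm] using hI x
    have hI2 : Integrable (fun z : En N => (1 + ‖x - z‖ ^ 2) ^ (-a) * (δ + ‖z‖ ^ 2) ^ (-b)) := by
      have := hI1.comp_neg
      simpa only [norm_neg, ← sub_eq_add_neg] using this
    have hsymm : ∫ z : En N, (1 + ‖x - z‖ ^ 2) ^ (-a) * (δ + ‖z‖ ^ 2) ^ (-b) =
        ∫ z : En N, (1 + ‖x + z‖ ^ 2) ^ (-a) * (δ + ‖z‖ ^ 2) ^ (-b) := by
      rw [← integral_neg_eq_self]
      simp only [norm_neg, sub_neg_eq_add]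
    have hsplit : ∫ z : En N, G z * (δ + ‖z‖ ^ 2) ^ (-b) =
        2 * (∫ z : En N, (1 + ‖x + z‖ ^ 2) ^ (-a) * (δ + ‖z‖ ^ 2) ^ (-b)) -
        2 * (1 + ‖x‖ ^ 2) ^ (-a) * ∫ z : En N, (δ + ‖z‖ ^ 2) ^ (-b) := by
      have e : ∀ z, G z * (δ + ‖z‖ ^ 2) ^ (-b) =
          ((1 + ‖x + z‖ ^ 2) ^ (-a) * (δ + ‖z‖ ^ 2) ^ (-b) +
          (1 + ‖x - z‖ ^ 2) ^ (-a) * (δ + ‖z‖ ^ 2) ^ (-b)) -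
          2 * (1 + ‖x‖ ^ 2) ^ (-a) * (δ + ‖z‖ ^ 2) ^ (-b) := by
        intro z
        rw [hG]; ring
      simp_rw [e]
      have h3 := i1.const_mul (2 * (1 + ‖x‖ ^ 2) ^ (-a))
      have h4 : Integrable (fun z : En N => (1 + ‖x + z‖ ^ 2) ^ (-a) * (δ + ‖z‖ ^ 2) ^ (-b) +
          (1 + ‖x - z‖ ^ 2) ^ (-a) * (δ + ‖z‖ ^ 2) ^ (-b)) := hI1.add hI2
      rw [integral_sub h4 h3, integral_add hI1 hI2, hsymm, integral_const_mul]
      ring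
    symm
    rw [hsplit]
    have j2 : ∫ z : En N, (δ + ‖z‖ ^ 2) ^ (-b) =
        π ^ ((N : ℝ) / 2) * (Real.Gamma s * δ ^ (-s)) / Real.Gamma b := by
      rw [← i2]; field_simp
    have j3 := eq_div_of_mul_eq (by positivity) ((mul_comm _ _).trans i3)
    rw [j2, j3]
    simp only [Function.comp_apply]
    field_simp
    ring
  have hfin := tendsto_nhds_unique L1 L3
  refine hfin.trans ?_
  field_simp
  ring

theorem fracLap_hAux
    (N : ℕ) (hN : 2 ≤ N) (s : ℝ) (hs : s ∈ Set.Ioo (0 : ℝ) 1) :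
    ∀ x : En N,
      Integrable (fun z : En N =>
        (hAux N ((N : ℝ) - 2 * s) (x + z) + hAux N ((N : ℝ) - 2 * s) (x - z) -
            2 * hAux N ((N : ℝ) - 2 * s) x) / ‖z‖ ^ ((N : ℝ) + 2 * s)) ∧
      -(Cns N s / 2) *
          ∫ z : En N,
            (hAux N ((N : ℝ) - 2 * s) (x + z) + hAux N ((N : ℝ) - 2 * s) (x - z) -
                2 * hAux N ((N : ℝ) - 2 * s) x) / ‖z‖ ^ ((N : ℝ) + 2 * s) =
        2 ^ (2 * s) * (Real.Gamma ((N : ℝ) / 2 + s) / Real.Gamma ((N : ℝ) / 2 - s)) *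
          hAux N ((N : ℝ) + 2 * s) x := by
  intro x
  have hN' : (2:ℝ) ≤ N := by exact_mod_cast hN
  have ha : 0 < (N : ℝ) / 2 - s := by linarith [hs.2]
  have hb : 0 < (N : ℝ) / 2 + s := by linarith [hs.1]
  have e1 : ∀ w : En N, hAux N ((N : ℝ) - 2 * s) w = (1 + ‖w‖ ^ 2) ^ (-((N : ℝ) / 2 - s)) := by
    intro w
    unfold hAux
    congr 1
    ring
  have e2 : hAux N ((N : ℝ) + 2 * s) x = (1 + ‖x‖ ^ 2) ^ (-((N : ℝ) / 2 + s)) := by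
    unfold hAux
    congr 1
    ring
  simp only [e1, e2]
  refine ⟨int_main hN hs ha x, ?_⟩
  rw [core hN hs ha rfl rfl x]
  unfold Cns
  have h4 : (2:ℝ) ^ (2 * s) = 4 ^ s := by
    rw [Real.rpow_mul (by norm_num)]; norm_num
  have hab : ((N : ℝ) + 2 * s) / 2 = (N : ℝ) / 2 + s := by ring
  have hGn : 0 < |Real.Gamma (-s)| := by
    rw [abs_pos]
    intro h
    have h1 : Real.Gamma (-s + 1) = -s * Real.Gamma (-s) :=
      Real.Gamma_add_one (by linarith [hs.1])
    have h2 : 0 < Real.Gamma (-s + 1) := Real.Gamma_pos_of_pos (by linarith [hs.2])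
    rw [h1, h, mul_zero] at h2
    exact lt_irrefl _ h2
  have hGa := Real.Gamma_pos_of_pos ha
  rw [h4, hab]
  have hpi : 0 < π ^ ((N : ℝ) / 2) := by positivity
  generalize π ^ ((N : ℝ) / 2) = q at *
  generalize Real.Gamma ((N : ℝ) / 2 - s) = ga at *
  generalize |Real.Gamma (-s)| = gs at *
  field_simp

end
end

section
/- Let λ, γ > 0, ρ > 0, β ∈ (N/2, N+2s], and set h_β(x) := (1+|x|²)^{−β/2}. Let u : ℝ^N → ℝ be continuous and bounded with u(x) → 0 as |x| → ∞, and assume that for every x with |x| > ρ the integral defining (−Δ)^s u(x) converges absolutely and (−Δ)^s u(x) + λ u(x) = γ h_β(x). Then limsup_{|x|→∞} u(x)|x|^β < +∞; moreover, if β < N+2s, then lim_{|x|→∞} u(x)|x|^β = γ/λ. -/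
open MeasureTheory Real Filter

noncomputable section

/-- The fractional Laplacian, defined pointwise via the second-difference integral. -/
def fracLap (N : ℕ) (s : ℝ) (u : En N → ℝ) (x : En N) : ℝ :=
  -(Cns N s / 2) * ∫ z, (u (x + z) + u (x - z) - 2 * u x) / ‖z‖ ^ ((N : ℝ) + 2 * s)

/-- The filter of neighbourhoods of infinity `|x| → ∞` on `ℝ^N`. -/
def atInfty (N : ℕ) : Filter (En N) := Filter.comap (fun x => ‖x‖) Filter.atTop


lemma bern {b r : ℝ} (hb : 0 ≤ b) (hr : 0 < r) : 1 - b * (r - 1) ≤ r ^ (-b) := by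
  rw [Real.rpow_def_of_pos hr]
  have h1 := Real.add_one_le_exp (Real.log r * -b)
  have h2 := Real.log_le_sub_one_of_pos hr
  nlinarith

lemma tang {b r : ℝ} (hb : 0 ≤ b) (hr : 0 < r) :
    r ^ (-b) ≤ 1 + b * r ^ (-b - 1) * (1 - r) := by
  have h := bern hb (inv_pos.2 hr)
  have h1 : (r⁻¹) ^ (-b) * r ^ (-b) = 1 := by
    rw [← Real.mul_rpow (by positivity) hr.le, inv_mul_cancel₀ hr.ne', Real.one_rpow]
  have h2 : r ^ (-b - 1) = r ^ (-b) * r⁻¹ := by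
    rw [Real.rpow_sub hr, Real.rpow_one, div_eq_mul_inv]
  have h3 : 0 < r ^ (-b) := by positivity
  have h4 := mul_le_mul_of_nonneg_right h h3.le
  rw [h1] at h4
  rw [h2]
  have : r⁻¹ * r = 1 := inv_mul_cancel₀ hr.ne'
  have e : b * (r ^ (-b) * r⁻¹) * (1 - r) = b * r ^ (-b) * (r⁻¹ - 1) := by
    linear_combination (- b * r ^ (-b)) * this
  rw [e]; linarith

lemma quad_upper {b r : ℝ} (hb : 0 ≤ b) (hr : 1 / 4 ≤ r) :
    r ^ (-b) ≤ 1 - b * (r - 1) + b * (b + 1) * 4 ^ (b + 2) * (r - 1) ^ 2 := by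
  have hr0 : 0 < r := by linarith
  have h1 := tang hb hr0
  have hM : (1:ℝ) ≤ 4 ^ (b + 2) := Real.one_le_rpow (by norm_num) (by linarith)
  have key : (1 - r) * (r ^ (-b - 1) - 1) ≤ (b + 1) * 4 ^ (b + 2) * (r - 1) ^ 2 := by
    rcases le_total 1 r with h | h
    · have h2 := bern (b := b + 1) (by linarith) hr0
      have e : -(b + 1) = -b - 1 := by ring
      rw [e] at h2
      have : (1 - r) * (r ^ (-b - 1) - 1) ≤ (b + 1) * (r - 1) ^ 2 := by nlinarith
      have h5 : (b + 1) * (r - 1) ^ 2 * 1 ≤ (b + 1) * (r - 1) ^ 2 * 4 ^ (b + 2) :=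
        mul_le_mul_of_nonneg_left hM (by positivity)
      nlinarith
    · have h2 := tang (b := b + 1) (by linarith) hr0
      have e : -(b + 1) = -b - 1 := by ring
      rw [e] at h2
      have h3 : r ^ (-b - 1 - 1) ≤ 4 ^ (b + 2) := by
        have : r ^ (-b - 1 - 1) = (r⁻¹) ^ (b + 2) := by
          rw [Real.inv_rpow hr0.le, ← Real.rpow_neg hr0.le]; congr 1; ring
        rw [this]
        apply Real.rpow_le_rpow (by positivity) _ (by linarith)
        rw [inv_le_comm₀ hr0 (by norm_num)]; linarith
      have h4 : r ^ (-b - 1) - 1 ≤ (b + 1) * 4 ^ (b + 2) * (1 - r) := by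
        have : (b + 1) * r ^ (-b - 1 - 1) * (1 - r) ≤ (b + 1) * 4 ^ (b + 2) * (1 - r) := by
          gcongr
        linarith
      have := mul_le_mul_of_nonneg_left h4 (sub_nonneg.2 h)
      nlinarith
  have := mul_le_mul_of_nonneg_left key hb
  nlinarith

lemma pw1 {b : ℝ} (hb : 0 < b) : ∃ C : ℝ, 0 < C ∧ ∀ q rp rm : ℝ, 0 ≤ q → 0 < rp → 0 < rm →
    rp + rm = 2 + 2 * q ^ 2 → |rp - 1| ≤ q ^ 2 + 2 * q → |rm - 1| ≤ q ^ 2 + 2 * q →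
    |rp ^ (-b) + rm ^ (-b) - 2| ≤ C * min 1 (q ^ 2) +
      ((if rp < 1 / 4 then rp ^ (-b) else 0) + (if rm < 1 / 4 then rm ^ (-b) else 0)) := by
  set M : ℝ := b * (b + 1) * 4 ^ (b + 2) with hM
  have hM0 : 0 < M := by positivity
  refine ⟨2 * b + 12 * M + 16 * (2 * 4 ^ b + 2), by positivity, ?_⟩
  intro q rp rm hq hp hm hsum h1 h2
  have h4 : (0:ℝ) < 4 ^ b := by positivity
  rcases le_or_gt q (1 / 4) with hq4 | hq4
  · have a1 := abs_le.1 h1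
    have a2 := abs_le.1 h2
    have hp4 : 1 / 4 ≤ rp := by nlinarith
    have hm4 : 1 / 4 ≤ rm := by nlinarith
    rw [if_neg (not_lt.2 hp4), if_neg (not_lt.2 hm4)]
    have u1 := quad_upper hb.le hp4
    have u2 := quad_upper hb.le hm4
    have l1 := bern hb.le hp
    have l2 := bern hb.le hm
    rw [← hM] at u1 u2
    have hmin : min 1 (q ^ 2) = q ^ 2 := min_eq_right (by nlinarith)
    rw [hmin]
    have bnd : (q ^ 2 + 2 * q) ^ 2 ≤ 6 * q ^ 2 := by
      have : q ^ 2 + 2 * q ≤ (9 / 4) * q := by nlinarith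
      have h0 : 0 ≤ q ^ 2 + 2 * q := by positivity
      nlinarith
    have s1 : (rp - 1) ^ 2 ≤ 6 * q ^ 2 := le_trans (sq_le_sq' a1.1 a1.2) bnd
    have s2 : (rm - 1) ^ 2 ≤ 6 * q ^ 2 := le_trans (sq_le_sq' a2.1 a2.2) bnd
    have s3 := mul_le_mul_of_nonneg_left s1 hM0.le
    have s4 := mul_le_mul_of_nonneg_left s2 hM0.le
    have e : b * (rp - 1) + b * (rm - 1) = 2 * b * q ^ 2 := by linear_combination b * hsum
    have c1 : 0 ≤ b * q ^ 2 := by positivity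
    have c2 : 0 ≤ M * q ^ 2 := by positivity
    have c3 : 0 ≤ 4 ^ b * q ^ 2 := by positivity
    have c4 : 0 ≤ q ^ 2 := by positivity
    rw [abs_le]
    constructor <;> nlinarith
  · have hmin : 1 / 16 ≤ min 1 (q ^ 2) := le_min (by norm_num) (by nlinarith)
    have aux : ∀ r : ℝ, 0 < r → r ^ (-b) ≤ 4 ^ b + (if r < 1 / 4 then r ^ (-b) else 0) := by
      intro r hr
      split_ifs with h
      · linarith
      · push Not at h
        rw [add_zero, Real.rpow_neg hr.le, ← Real.inv_rpow hr.le]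
        apply Real.rpow_le_rpow (by positivity) _ hb.le
        rw [inv_le_comm₀ hr (by norm_num)]; linarith
    have b1 := aux rp hp
    have b2 := aux rm hm
    have p1 : 0 < rp ^ (-b) := by positivity
    have p2 : 0 < rm ^ (-b) := by positivity
    have : (2 * b + 12 * M + 16 * (2 * 4 ^ b + 2)) * (1 / 16) ≤
      (2 * b + 12 * M + 16 * (2 * 4 ^ b + 2)) * min 1 (q ^ 2) :=
      mul_le_mul_of_nonneg_left hmin (by positivity)
    rw [abs_le]
    constructor <;> linarith

def kern (p : ℝ) (q : ℝ) : ℝ := min 1 (q ^ 2) / q ^ p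

lemma kern_nonneg (p : ℝ) {q : ℝ} (hq : 0 ≤ q) : 0 ≤ kern p q := by
  unfold kern; positivity

set_option maxHeartbeats 2000000 in
lemma pw2 (N : ℕ) {β p η : ℝ} (hβ : 0 < β) (hη0 : 0 ≤ η) (hη : η ≤ p - β) :
    ∃ C : ℝ, 0 < C ∧ ∀ x z : En N, z ≠ 0 →
      |(hAux N β (x + z) + hAux N β (x - z) - 2 * hAux N β x) / ‖z‖ ^ p| ≤
        C * hAux N β x * ((1 + ‖x‖ ^ 2) ^ (-p / 2) * kern p (‖(Real.sqrt (1 + ‖x‖ ^ 2))⁻¹ • z‖) +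
          (1 + ‖x‖ ^ 2) ^ (-η / 2) * (hAux N (p - η) (x + z) + hAux N (p - η) (x - z))) := by
  obtain ⟨C, hC, hpw⟩ := pw1 (b := β / 2) (by linarith)
  refine ⟨C + 4 ^ p, by positivity, ?_⟩
  intro x z hz
  have hp : 0 < p := by linarith
  set t : ℝ := 1 + ‖x‖ ^ 2 with ht
  have ht0 : 0 < t := by positivity
  have hst : 0 < √t := Real.sqrt_pos.2 ht0
  have hz0 : 0 < ‖z‖ := norm_pos_iff.2 hz
  set q : ℝ := ‖z‖ / √t with hqd
  have hq0 : 0 < q := by positivity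
  have hnq : ‖(√t)⁻¹ • z‖ = q := by
    rw [norm_smul, Real.norm_of_nonneg (by positivity), hqd]; field_simp
  rw [hnq]
  have hzq : ‖z‖ = q * √t := by rw [hqd]; field_simp
  have hxs : ‖x‖ ≤ √t := Real.le_sqrt_of_sq_le (by rw [ht]; linarith)
  have hsq : √t ^ 2 = t := Real.sq_sqrt ht0.le
  have hin := abs_le.1 (abs_real_inner_le_norm x z)
  have eqp : 1 + ‖x + z‖ ^ 2 = t + 2 * inner ℝ x z + ‖z‖ ^ 2 := by
    rw [norm_add_sq_real]; ring
  have eqm : 1 + ‖x - z‖ ^ 2 = t - 2 * inner ℝ x z + ‖z‖ ^ 2 := by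
    rw [norm_sub_sq_real]; ring
  set tp : ℝ := 1 + ‖x + z‖ ^ 2 with htp
  set tm : ℝ := 1 + ‖x - z‖ ^ 2 with htm
  have htp0 : 0 < tp := by positivity
  have htm0 : 0 < tm := by positivity
  have hinb : ‖x‖ * ‖z‖ ≤ q * t := by
    calc ‖x‖ * ‖z‖ ≤ √t * ‖z‖ := by gcongr
      _ = q * t := by rw [hzq]; nlinarith
  have hz2 : ‖z‖ ^ 2 = q ^ 2 * t := by rw [hzq, mul_pow, hsq]
  have hq2t : 0 ≤ q ^ 2 * t := by positivity
  have main := hpw q (tp / t) (tm / t) hq0.le (by positivity) (by positivity)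
    (by rw [← add_div, div_eq_iff ht0.ne']; linarith)
    (by
      rw [show tp / t - 1 = (tp - t) / t by field_simp, abs_div, abs_of_pos ht0,
        div_le_iff₀ ht0, abs_le]
      constructor <;> nlinarith)
    (by
      rw [show tm / t - 1 = (tm - t) / t by field_simp, abs_div, abs_of_pos ht0,
        div_le_iff₀ ht0, abs_le]
      constructor <;> nlinarith)
  have hdiv : ∀ a : ℝ, 0 < a → (a / t) ^ (-(β / 2)) * t ^ (-β / 2) = a ^ (-β / 2) := by
    intro a ha
    rw [neg_div, ← Real.mul_rpow (by positivity) ht0.le, div_mul_cancel₀ _ ht0.ne']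
  have hh : 0 < t ^ (-β / 2) := by positivity
  have hzp : 0 < ‖z‖ ^ p := by positivity
  have hstp : √t ^ p = t ^ (p / 2) := by
    rw [Real.sqrt_eq_rpow, ← Real.rpow_mul ht0.le]; congr 1; ring
  have hzpe : ‖z‖ ^ p = q ^ p * t ^ (p / 2) := by
    rw [hzq, Real.mul_rpow hq0.le hst.le, hstp]
  have hneg : t ^ (-p / 2) = (t ^ (p / 2))⁻¹ := by rw [neg_div, Real.rpow_neg ht0.le]
  -- the tail terms
  have tail : ∀ a : ℝ, 0 < a → (a / t < 1 / 4 → 1 / 4 ≤ q) →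
      (if a / t < 1 / 4 then (a / t) ^ (-(β / 2)) else 0) / ‖z‖ ^ p ≤
        4 ^ p * (t ^ (-η / 2) * a ^ (-(p - η) / 2)) := by
    intro a ha hq4
    split_ifs with h
    · have hq4 := hq4 h
      have hat : a ≤ t := by
        rw [div_lt_iff₀ ht0] at h; linarith
      have e1 : (‖z‖ ^ p)⁻¹ ≤ 4 ^ p * t ^ (-p / 2) := by
        rw [hzpe, mul_inv, hneg]
        gcongr
        rw [← Real.inv_rpow hq0.le]
        apply Real.rpow_le_rpow (by positivity) _ hp.le
        rw [inv_le_comm₀ hq0 (by norm_num)]; linarith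
      have e2 : (a / t) ^ (-(β / 2)) = a ^ (-β / 2) * t ^ (β / 2) := by
        rw [Real.div_rpow ha.le ht0.le, Real.rpow_neg ht0.le, neg_div]; field_simp
      rw [div_eq_mul_inv]
      calc (a / t) ^ (-(β / 2)) * (‖z‖ ^ p)⁻¹ ≤ (a / t) ^ (-(β / 2)) * (4 ^ p * t ^ (-p / 2)) := by
            gcongr
        _ = 4 ^ p * (t ^ (-η / 2) * (a ^ (-β / 2) * t ^ (-((p - β - η) / 2)))) := by
            rw [e2, show -p / 2 = -η / 2 + (-((p - β - η) / 2)) + (-(β / 2)) by ring,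
              Real.rpow_add ht0, Real.rpow_add ht0, Real.rpow_neg ht0.le (β / 2)]
            field_simp
        _ ≤ 4 ^ p * (t ^ (-η / 2) * (a ^ (-β / 2) * a ^ (-((p - β - η) / 2)))) := by
            gcongr 4 ^ p * (t ^ (-η / 2) * (a ^ (-β / 2) * ?_))
            exact Real.rpow_le_rpow_of_nonpos ha hat (by linarith)
        _ = _ := by
            rw [← Real.rpow_add ha]; congr 3; ring
    · rw [zero_div]; positivity
  have t1 := tail tp htp0 (by
    intro h; by_contra hc; push Not at hc
    rw [div_lt_iff₀ ht0] at h
    nlinarith [mul_pos hq0 ht0, mul_lt_mul_of_pos_right hc ht0])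
  have t2 := tail tm htm0 (by
    intro h; by_contra hc; push Not at hc
    rw [div_lt_iff₀ ht0] at h
    nlinarith [mul_pos hq0 ht0, mul_lt_mul_of_pos_right hc ht0])
  have hDe : hAux N β (x + z) + hAux N β (x - z) - 2 * hAux N β x =
      ((tp / t) ^ (-(β / 2)) + (tm / t) ^ (-(β / 2)) - 2) * t ^ (-β / 2) := by
    unfold hAux
    rw [sub_mul, add_mul, hdiv tp htp0, hdiv tm htm0]
  rw [hDe, abs_div, abs_mul, abs_of_pos hh, abs_of_pos hzp]
  have hx : hAux N β x = t ^ (-β / 2) := rfl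
  have hp1 : hAux N (p - η) (x + z) = tp ^ (-(p - η) / 2) := rfl
  have hp2 : hAux N (p - η) (x - z) = tm ^ (-(p - η) / 2) := rfl
  rw [hx, hp1, hp2]
  have hk : min 1 (q ^ 2) / ‖z‖ ^ p = t ^ (-p / 2) * kern p q := by
    unfold kern; rw [hzpe, hneg]; field_simp
  have hk0 : 0 ≤ t ^ (-p / 2) * kern p q := mul_nonneg (by positivity) (kern_nonneg p hq0.le)
  have hb0 : 0 ≤ t ^ (-η / 2) * (tp ^ (-(p - η) / 2) + tm ^ (-(p - η) / 2)) := by positivity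
  clear_value tp tm
  have fin1 := div_le_div_of_nonneg_right main hzp.le
  rw [add_div, add_div, mul_div_assoc, hk] at fin1
  rw [mul_div_right_comm, mul_comm, mul_comm (C + 4 ^ p), mul_assoc]
  apply mul_le_mul_of_nonneg_left _ hh.le
  have h4p : (0:ℝ) < 4 ^ p := by positivity
  nlinarith [mul_nonneg hC.le hb0, mul_nonneg h4p.le hk0]

lemma kern_int (N : ℕ) (hN : 2 ≤ N) {s : ℝ} (hs : s ∈ Set.Ioo (0:ℝ) 1) :
    Integrable (fun z : En N => kern ((N:ℝ) + 2 * s) ‖z‖) := by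
  have : Nonempty (Fin N) := ⟨⟨0, by omega⟩⟩
  have : Nontrivial (En N) := inferInstance
  rw [integrable_fun_norm_addHaar (volume : Measure (En N)) (f := kern ((N:ℝ) + 2 * s)),
    ← Set.Ioc_union_Ioi_eq_Ioi (zero_le_one (α := ℝ))]
  have hfin : Module.finrank ℝ (En N) = N := by simp
  rw [hfin]
  have hcast : ((N - 1 : ℕ) : ℝ) = (N:ℝ) - 1 := by
    rw [Nat.cast_sub (by omega)]; simp
  apply IntegrableOn.union
  · have h1 : IntegrableOn (fun y : ℝ => y ^ (1 - 2 * s)) (Set.Ioc 0 1) :=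
      (intervalIntegrable_iff_integrableOn_Ioc_of_le zero_le_one).1
        (intervalIntegral.intervalIntegrable_rpow' (by linarith [hs.2]))
    refine h1.congr_fun ?_ measurableSet_Ioc
    intro y hy
    have hy0 : 0 < y := hy.1
    simp only [kern, smul_eq_mul]
    rw [min_eq_right (by nlinarith [hy.2]), ← Real.rpow_natCast y (N - 1), hcast,
      ← Real.rpow_natCast y 2, ← Real.rpow_sub hy0, ← Real.rpow_add hy0]
    congr 1; push_cast; ring
  · have h1 : IntegrableOn (fun y : ℝ => y ^ (-1 - 2 * s)) (Set.Ioi 1) :=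
      integrableOn_Ioi_rpow_of_lt (by linarith [hs.1]) zero_lt_one
    refine h1.congr_fun ?_ measurableSet_Ioi
    intro y hy
    have hy1 : 1 < y := hy
    have hy0 : 0 < y := by linarith
    simp only [kern, smul_eq_mul]
    rw [min_eq_left (by nlinarith), ← Real.rpow_natCast y (N - 1), hcast,
      one_div, ← Real.rpow_neg hy0.le, ← Real.rpow_add hy0]
    congr 1; ring

lemma hAux_pos (N : ℕ) (β : ℝ) (x : En N) : 0 < hAux N β x := by
  unfold hAux; positivity

lemma hAux_cont (N : ℕ) (β : ℝ) : Continuous (hAux N β) := by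
  unfold hAux
  apply Continuous.rpow_const (by fun_prop)
  intro x; left; positivity

/-- second-difference integrand -/
def secd (N : ℕ) (s : ℝ) (u : En N → ℝ) (x z : En N) : ℝ :=
  (u (x + z) + u (x - z) - 2 * u x) / ‖z‖ ^ ((N : ℝ) + 2 * s)

lemma est (N : ℕ) (hN : 2 ≤ N) {s β η : ℝ} (hs : s ∈ Set.Ioo (0:ℝ) 1) (hβ : 0 < β)
    (hη0 : 0 ≤ η) (hη : η ≤ (N:ℝ) + 2 * s - β) (hη2 : η < 2 * s) :
    ∃ C : ℝ, 0 < C ∧ ∀ x : En N, Integrable (secd N s (hAux N β) x) ∧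
      |∫ z, secd N s (hAux N β) x z| ≤ C * (1 + ‖x‖ ^ 2) ^ (-η / 2) * hAux N β x := by
  set p : ℝ := (N:ℝ) + 2 * s with hp
  obtain ⟨C, hC, hpw⟩ := pw2 N hβ hη0 hη
  have hfin : Module.finrank ℝ (En N) = N := by simp
  have hK := kern_int N hN hs
  rw [← hp] at hK
  have hH : Integrable (hAux N (p - η)) := by
    apply integrable_rpow_neg_one_add_norm_sq
    rw [hfin]; linarith
  set I : ℝ := ∫ z : En N, kern p ‖z‖ with hI
  set J : ℝ := ∫ z : En N, hAux N (p - η) z with hJ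
  have hI0 : 0 ≤ I := integral_nonneg (fun z => kern_nonneg p (norm_nonneg z))
  have hJ0 : 0 ≤ J := integral_nonneg (fun z => (hAux_pos N _ z).le)
  refine ⟨C * (I + 2 * J + 1), by positivity, ?_⟩
  intro x
  set t : ℝ := 1 + ‖x‖ ^ 2 with ht
  have ht1 : 1 ≤ t := by rw [ht]; nlinarith [sq_nonneg ‖x‖]
  have ht0 : 0 < t := by linarith
  have hR : 0 < (√t)⁻¹ := inv_pos.2 (Real.sqrt_pos.2 ht0)
  have hK' : Integrable (fun z : En N => kern p ‖(√t)⁻¹ • z‖) :=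
    (integrable_comp_smul_iff (volume : Measure (En N)) (fun z : En N => kern p ‖z‖) hR.ne').2 hK
  have hKi : ∫ z : En N, kern p ‖(√t)⁻¹ • z‖ = t ^ ((N:ℝ) / 2) * I := by
    rw [Measure.integral_comp_smul volume (fun z : En N => kern p ‖z‖) (√t)⁻¹, hfin, smul_eq_mul,
      abs_of_pos (by positivity), inv_pow, inv_inv, ← Real.rpow_natCast, Real.sqrt_eq_rpow,
      ← Real.rpow_mul ht0.le]
    congr 2; ring
  have hHp : Integrable (fun z : En N => hAux N (p - η) (x + z)) := hH.comp_add_left x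
  have hHm : Integrable (fun z : En N => hAux N (p - η) (x - z)) := hH.comp_sub_left x
  have hHpm : Integrable (fun z : En N => hAux N (p - η) (x + z) + hAux N (p - η) (x - z)) :=
    hHp.add hHm
  set G : En N → ℝ := fun z => C * hAux N β x * (t ^ (-p / 2) * kern p (‖(√t)⁻¹ • z‖) +
          t ^ (-η / 2) * (hAux N (p - η) (x + z) + hAux N (p - η) (x - z))) with hG
  have hGi : Integrable G :=
    ((hK'.const_mul _).add (hHpm.const_mul _)).const_mul _
  have hGint : ∫ z, G z = C * hAux N β x *
      (t ^ (-p / 2) * (t ^ ((N:ℝ) / 2) * I) + t ^ (-η / 2) * (J + J)) := by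
    rw [hG, integral_const_mul, integral_add (hK'.const_mul _) (hHpm.const_mul _),
      integral_const_mul, integral_const_mul, integral_add hHp hHm, hKi,
      integral_add_left_eq_self (hAux N (p - η)) x, integral_sub_left_eq_self (hAux N (p - η)) _ x]
  have hb : ∀ z, ‖secd N s (hAux N β) x z‖ ≤ G z := by
    intro z
    by_cases hz : z = 0
    · have hx0 : 0 < hAux N β x := hAux_pos _ _ _
      have h1 := hAux_pos N (p - η) (x + z)
      have h2 := hAux_pos N (p - η) (x - z)
      have h3 := kern_nonneg p (norm_nonneg ((√t)⁻¹ • z))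
      have hG0 : 0 ≤ G z := by rw [hG]; positivity
      have : secd N s (hAux N β) x z = 0 := by
        unfold secd; rw [hz]; simp; left; ring
      rw [this, norm_zero]; exact hG0
    · exact hpw x z hz
  have hmeas : AEStronglyMeasurable (secd N s (hAux N β) x) volume := by
    have hc := hAux_cont N β
    apply Measurable.aestronglyMeasurable
    unfold secd
    have hcm := hc.measurable
    exact (((hcm.comp (measurable_const_add x)).add
      (hcm.comp (measurable_id.const_sub x))).sub measurable_const).div
      (measurable_norm.pow_const _)
  refine ⟨hGi.mono' hmeas (Eventually.of_forall hb), ?_⟩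
  have h1 := norm_integral_le_of_norm_le hGi (Eventually.of_forall hb)
  rw [hGint] at h1
  refine h1.trans ?_
  have e1 : t ^ (-p / 2) * (t ^ ((N:ℝ) / 2) * I) ≤ t ^ (-η / 2) * I := by
    rw [← mul_assoc, ← Real.rpow_add ht0]
    gcongr
    rw [hp]; linarith
  have hx0 : 0 < hAux N β x := hAux_pos _ _ _
  calc _ ≤ C * hAux N β x * (t ^ (-η / 2) * I + t ^ (-η / 2) * (J + J)) := by gcongr
    _ ≤ C * hAux N β x * (t ^ (-η / 2) * I + t ^ (-η / 2) * (J + J)) +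
        C * hAux N β x * t ^ (-η / 2) := by
          have : 0 ≤ C * hAux N β x * t ^ (-η / 2) := by positivity
          linarith
    _ = _ := by ring

lemma scal (N : ℕ) {s ε : ℝ} (hε : 0 < ε) (f : En N → ℝ) (x : En N)
    (hf : Integrable (secd N s f (ε • x))) :
    Integrable (secd N s (fun y => f (ε • y)) x) ∧
    ∫ z, secd N s (fun y => f (ε • y)) x z = ε ^ (2 * s) * ∫ z, secd N s f (ε • x) z := by
  have hfin : Module.finrank ℝ (En N) = N := by simp
  have e : secd N s (fun y => f (ε • y)) x =
      fun z => ε ^ ((N:ℝ) + 2 * s) * secd N s f (ε • x) (ε • z) := by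
    funext z
    simp only [secd]
    rw [smul_add, smul_sub, norm_smul, Real.norm_of_nonneg hε.le,
      Real.mul_rpow hε.le (norm_nonneg z)]
    have : 0 < ε ^ ((N:ℝ) + 2 * s) := by positivity
    field_simp
  rw [e]
  constructor
  · exact ((integrable_comp_smul_iff volume _ hε.ne').2 hf).const_mul _
  · rw [integral_const_mul, Measure.integral_comp_smul, hfin, smul_eq_mul,
      abs_of_pos (by positivity), Real.rpow_add hε, Real.rpow_natCast]
    field_simp

lemma bar (N : ℕ) (hN : 2 ≤ N) {s β κ : ℝ} (hs : s ∈ Set.Ioo (0:ℝ) 1) (hβ : 0 < β)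
    (hβ2 : β ≤ (N:ℝ) + 2 * s) (hκ : 0 < κ) :
    ∃ ε : ℝ, 0 < ε ∧ ε ≤ 1 ∧ ∀ x : En N,
      Integrable (secd N s (fun y => hAux N β (ε • y)) x) ∧
      |∫ z, secd N s (fun y => hAux N β (ε • y)) x z| ≤ κ * hAux N β (ε • x) := by
  obtain ⟨C, hC, hest⟩ := est N hN hs hβ le_rfl (by linarith) (by linarith [hs.1] : (0:ℝ) < 2 * s)
  have hs0 := hs.1
  refine ⟨min 1 ((κ / C) ^ (1 / (2 * s))), lt_min one_pos (by positivity), min_le_left _ _, ?_⟩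
  set ε := min 1 ((κ / C) ^ (1 / (2 * s))) with hε
  have hε0 : 0 < ε := lt_min one_pos (by positivity)
  intro x
  obtain ⟨h1, h2⟩ := hest (ε • x)
  obtain ⟨h3, h4⟩ := scal N hε0 _ x h1
  refine ⟨h3, ?_⟩
  rw [h4, abs_mul, abs_of_pos (by positivity)]
  simp only [neg_zero, zero_div, Real.rpow_zero, mul_one] at h2
  have h5 : ε ^ (2 * s) ≤ κ / C := by
    calc ε ^ (2 * s) ≤ ((κ / C) ^ (1 / (2 * s))) ^ (2 * s) :=
          Real.rpow_le_rpow hε0.le (min_le_right _ _) (by linarith)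
      _ = κ / C := by
          rw [← Real.rpow_mul (by positivity), one_div, inv_mul_cancel₀ (by positivity),
            Real.rpow_one]
  have hx0 := hAux_pos N β (ε • x)
  calc ε ^ (2 * s) * |∫ z, secd N s (hAux N β) (ε • x) z|
      ≤ κ / C * (C * hAux N β (ε • x)) := by gcongr
    _ = _ := by field_simp

lemma atInfty_eq (N : ℕ) : atInfty N = Filter.cocompact (En N) := by
  unfold atInfty
  rw [← Metric.cobounded_eq_cocompact, ← comap_norm_atTop]

lemma comparison_principle (N : ℕ) {s c lam R : ℝ} (hc : 0 ≤ c) (hlam : 0 < lam) {u w : En N → ℝ}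
    (hu : Continuous u) (hw : Continuous w)
    (hu0 : Tendsto u (atInfty N) (nhds 0)) (hw0 : Tendsto w (atInfty N) (nhds 0))
    (hui : ∀ x, R < ‖x‖ → Integrable (secd N s u x))
    (hwi : ∀ x, R < ‖x‖ → Integrable (secd N s w x))
    (hle : ∀ x, R < ‖x‖ → -c * (∫ z, secd N s u x z) + lam * u x ≤
      -c * (∫ z, secd N s w x z) + lam * w x)
    (hin : ∀ x, ‖x‖ ≤ R → u x ≤ w x) : ∀ x, u x ≤ w x := by
  by_contra hcon
  push Not at hcon
  obtain ⟨x1, hx1⟩ := hcon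
  have hv0 : Tendsto (fun x => u x - w x) (Filter.cocompact (En N)) (nhds 0) := by
    rw [← atInfty_eq]; simpa using hu0.sub hw0
  obtain ⟨x0, hx0⟩ := (hu.sub hw).exists_forall_ge' x1 (by
    have := hv0.eventually (gt_mem_nhds (sub_pos.2 hx1))
    filter_upwards [this] with x hx
    exact hx.le)
  simp only [Pi.sub_apply] at hx0
  have hpos : 0 < u x0 - w x0 := lt_of_lt_of_le (sub_pos.2 hx1) (hx0 x1)
  have hR : R < ‖x0‖ := by
    by_contra h
    push Not at h
    linarith [hin x0 h]
  have hA : ∫ z, secd N s u x0 z ≤ ∫ z, secd N s w x0 z := by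
    apply integral_mono (hui x0 hR) (hwi x0 hR)
    intro z
    simp only [secd]
    gcongr ?_ / _
    linarith [hx0 (x0 + z), hx0 (x0 - z)]
  have := hle x0 hR
  have := mul_le_mul_of_nonneg_left hA hc
  nlinarith [mul_pos hlam hpos]

lemma hAux_bd (N : ℕ) {β ε : ℝ} (hβ : 0 ≤ β) (hε : 0 < ε) (x : En N) :
    hAux N β (ε • x) * ‖x‖ ^ β ≤ ε ^ (-β) := by
  rcases eq_or_lt_of_le (norm_nonneg x) with h0 | h0
  · rcases eq_or_lt_of_le hβ with hb | hb
    · subst hb; simp [hAux]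
    · rw [← h0, Real.zero_rpow hb.ne', mul_zero]; positivity
  · have e : ‖x‖ ^ β = (‖x‖ ^ 2) ^ (β / 2) := by
      rw [← Real.rpow_natCast, ← Real.rpow_mul h0.le]; congr 1; push_cast; ring
    have e2 : ε ^ (-β) = (ε ^ 2) ^ (-β / 2) := by
      rw [← Real.rpow_natCast, ← Real.rpow_mul hε.le]; congr 1; push_cast; ring
    have e3 : (ε ^ 2) ^ (-β / 2) = (ε ^ 2 * ‖x‖ ^ 2) ^ (-β / 2) * (‖x‖ ^ 2) ^ (β / 2) := by
      rw [Real.mul_rpow (by positivity) (by positivity), neg_div,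
        Real.rpow_neg (x := ‖x‖ ^ 2) (by positivity)]
      field_simp
    rw [e2, e3, e]
    gcongr
    unfold hAux
    rw [norm_smul, Real.norm_of_nonneg hε.le, mul_pow]
    apply Real.rpow_le_rpow_of_nonpos (by positivity) (by linarith) (by linarith)

lemma norm_atInfty (N : ℕ) : Tendsto (fun x : En N => ‖x‖) (atInfty N) atTop := tendsto_comap

lemma hAux_lim0 (N : ℕ) {β β' ε : ℝ} (hβ : β < β') (hβ' : 0 < β') (hε : 0 < ε) :
    Tendsto (fun x => hAux N β' (ε • x) * ‖x‖ ^ β) (atInfty N) (nhds 0) := by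
  have h1 : Tendsto (fun x : En N => ε ^ (-β') * ‖x‖ ^ (-(β' - β))) (atInfty N) (nhds 0) := by
    simpa using ((tendsto_rpow_neg_atTop (sub_pos.2 hβ)).comp (norm_atInfty N)).const_mul (ε ^ (-β'))
  apply squeeze_zero' _ _ h1
  · exact Eventually.of_forall (fun x => by have := hAux_pos N β' (ε • x); positivity)
  · filter_upwards [(norm_atInfty N).eventually_gt_atTop 0] with x hx
    have := hAux_bd N hβ'.le hε x
    have e : ‖x‖ ^ β = ‖x‖ ^ β' * ‖x‖ ^ (-(β' - β)) := by
      rw [← Real.rpow_add hx]; congr 1; ring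
    rw [e, ← mul_assoc]
    gcongr

lemma hAux_lim1 (N : ℕ) {β : ℝ} :
    Tendsto (fun x => hAux N β x * ‖x‖ ^ β) (atInfty N) (nhds 1) := by
  have h1 : Tendsto (fun x : En N => (1 + (‖x‖ ^ 2)⁻¹) ^ (-β / 2)) (atInfty N) (nhds 1) := by
    have h2 : Tendsto (fun x : En N => 1 + (‖x‖ ^ 2)⁻¹) (atInfty N) (nhds 1) := by
      simpa using (tendsto_inv_atTop_zero.comp
        ((tendsto_pow_atTop (two_ne_zero)).comp (norm_atInfty N))).const_add (1:ℝ)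
    simpa using h2.rpow_const (p := -β / 2) (Or.inl one_ne_zero)
  refine h1.congr' ?_
  filter_upwards [(norm_atInfty N).eventually_gt_atTop 0] with x hx
  have e : ‖x‖ ^ β = (‖x‖ ^ 2) ^ (β / 2) := by
    rw [← Real.rpow_natCast, ← Real.rpow_mul hx.le]; congr 1; push_cast; ring
  unfold hAux
  rw [e, show 1 + ‖x‖ ^ 2 = (1 + (‖x‖ ^ 2)⁻¹) * ‖x‖ ^ 2 by field_simp; ring,
    Real.mul_rpow (by positivity) (by positivity), neg_div,
    Real.rpow_neg (x := ‖x‖ ^ 2) (by positivity)]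
  field_simp

lemma hAux_lim (N : ℕ) {β ε : ℝ} (hβ : 0 < β) (hε : 0 < ε) :
    Tendsto (fun x => hAux N β (ε • x)) (atInfty N) (nhds 0) := by
  simpa using hAux_lim0 N (β := 0) hβ hβ hε

/-- upper bound lemma -/
lemma upper1 (N : ℕ) (hN : 2 ≤ N) {s c lam R κ β : ℝ} (hs : s ∈ Set.Ioo (0:ℝ) 1) (hc : 0 ≤ c)
    (hlam : 0 < lam) (hβ : 0 < β) (hβ2 : β ≤ (N:ℝ) + 2 * s) (hκ : 0 < κ) {u : En N → ℝ}
    (hu : Continuous u) (hub : ∃ B : ℝ, ∀ x, |u x| ≤ B)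
    (hu0 : Tendsto u (atInfty N) (nhds 0))
    (hui : ∀ x, R < ‖x‖ → Integrable (secd N s u x))
    (hsol : ∀ x, R < ‖x‖ → -c * (∫ z, secd N s u x z) + lam * u x ≤ κ * hAux N β x) :
    ∃ K : ℝ, ∀ x, u x * ‖x‖ ^ β ≤ K := by
  obtain ⟨B, hB⟩ := hub
  obtain ⟨ε, hε, hε1, hbar⟩ := bar N hN (κ := lam / (2 * (c + 1))) hs hβ hβ2 (by positivity)
  -- the barrier is bounded below on the ball of radius R
  set m : ℝ := (1 + R ^ 2) ^ (-β / 2) with hm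
  have hm0 : 0 < m := by positivity
  have hB0 : 0 ≤ B := (abs_nonneg _).trans (hB 0)
  set K : ℝ := B / m + 2 * κ / lam with hK
  have hK0 : 0 ≤ K := by positivity
  have hKe : K * lam / 2 ≥ κ := by
    rw [hK]
    have : 0 ≤ B / m := by positivity
    have : 2 * κ / lam * lam / 2 = κ := by field_simp
    nlinarith
  set Φ : En N → ℝ := fun y => hAux N β (ε • y) with hΦ
  have hΦh : ∀ x, hAux N β x ≤ Φ x := by
    intro x
    simp only [hΦ, hAux]
    apply Real.rpow_le_rpow_of_nonpos (by positivity) _ (by linarith)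
    rw [norm_smul, Real.norm_of_nonneg hε.le]
    have : ε * ‖x‖ ≤ ‖x‖ := mul_le_of_le_one_left (norm_nonneg x) hε1
    gcongr
  have hscale : secd N s (fun x => K * Φ x) = fun x z => K * secd N s Φ x z := by
    funext x z; simp only [secd]; ring
  have main := comparison_principle N (s := s) (R := R) hc hlam hu
    (w := fun x => K * Φ x)
    (continuous_const.mul ((hAux_cont N β).comp (continuous_const_smul ε)))
    hu0 (by simpa using (hAux_lim N hβ hε).const_mul K) hui
    (fun x _ => by rw [hscale]; exact (hbar x).1.const_mul K)
    (fun x hx => by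
      refine (hsol x hx).trans ?_
      rw [hscale, integral_const_mul]
      have h1 := (hbar x).2
      have h2 : 0 < Φ x := hAux_pos N β (ε • x)
      have h3 := (abs_le.1 h1).2
      have h4 : c * ∫ z, secd N s Φ x z ≤ lam / 2 * Φ x := by
        calc c * ∫ z, secd N s Φ x z ≤ c * (lam / (2 * (c + 1)) * Φ x) := by gcongr
          _ = c / (c + 1) * (lam / 2 * Φ x) := by field_simp
          _ ≤ 1 * (lam / 2 * Φ x) := by
              gcongr
              rw [div_le_one (by positivity)]; linarith
          _ = _ := one_mul _
      have h5 := mul_le_mul_of_nonneg_left h4 hK0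
      have h6 : κ * hAux N β x ≤ K * lam / 2 * Φ x :=
        mul_le_mul hKe (hΦh x) (hAux_pos N β x).le (by positivity)
      nlinarith)
    (fun x hx => by
      have h1 : m ≤ Φ x := by
        refine le_trans ?_ (hΦh x)
        simp only [hm, hAux]
        apply Real.rpow_le_rpow_of_nonpos (by positivity) _ (by linarith)
        gcongr
      have h2 : B / m * m = B := by field_simp
      have h3 : B ≤ K * Φ x := by
        rw [← h2]
        have : B / m ≤ K := by rw [hK]; have : 0 < 2 * κ / lam := by positivity
                               linarith
        gcongr
      exact ((le_abs_self _).trans (hB x)).trans h3)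
  refine ⟨K * ε ^ (-β), fun x => ?_⟩
  calc u x * ‖x‖ ^ β ≤ K * Φ x * ‖x‖ ^ β := by gcongr; exact main x
    _ = K * (Φ x * ‖x‖ ^ β) := by ring
    _ ≤ _ := by gcongr; exact hAux_bd N hβ.le hε x

lemma upper2 (N : ℕ) (hN : 2 ≤ N) {s c lam R κ β : ℝ} (hs : s ∈ Set.Ioo (0:ℝ) 1) (hc : 0 ≤ c)
    (hlam : 0 < lam) (hβ : 0 < β) (hβ2 : β < (N:ℝ) + 2 * s) {u : En N → ℝ}
    (hu : Continuous u) (hub : ∃ B : ℝ, ∀ x, |u x| ≤ B)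
    (hu0 : Tendsto u (atInfty N) (nhds 0))
    (hui : ∀ x, R < ‖x‖ → Integrable (secd N s u x))
    (hsol : ∀ x, R < ‖x‖ → -c * (∫ z, secd N s u x z) + lam * u x = κ * hAux N β x)
    {δ : ℝ} (hδ : 0 < δ) :
    ∀ᶠ x in atInfty N, u x * ‖x‖ ^ β < κ / lam + δ := by
  obtain ⟨B, hB⟩ := hub
  have hs0 := hs.1
  set η : ℝ := min s ((N:ℝ) + 2 * s - β) with hη
  have hη0 : 0 < η := lt_min hs0 (by linarith)
  obtain ⟨C, hC, hest⟩ := est N hN hs hβ hη0.le (min_le_right _ _)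
    ((min_le_left _ _).trans_lt (by linarith) : η < 2 * s)
  have hβ' : 0 < (N:ℝ) + 2 * s := by linarith
  obtain ⟨ε, hε, hε1, hbar⟩ := bar N hN (κ := lam / (c + 1)) hs hβ' le_rfl (by positivity)
  set Φ : En N → ℝ := fun y => hAux N ((N:ℝ) + 2 * s) (ε • y) with hΦ
  set a : ℝ := κ / lam + δ / 2 with ha
  -- choose the radius
  have hsm : Tendsto (fun x : En N => |a| * c * (C * (1 + ‖x‖ ^ 2) ^ (-η / 2))) (atInfty N)
      (nhds 0) := by
    have h1 : Tendsto (fun x : En N => (1 + ‖x‖ ^ 2) ^ (-η / 2)) (atInfty N) (nhds 0) := by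
      have := hAux_lim N hη0 (one_pos (α := ℝ))
      simpa [hAux] using this
    simpa using (h1.const_mul C).const_mul (|a| * c)
  have hev := hsm.eventually (gt_mem_nhds (show (0:ℝ) < lam * (δ / 2) by positivity))
  unfold atInfty at hev
  rw [eventually_comap, eventually_atTop] at hev
  obtain ⟨R1, hR1⟩ := hev
  set R2 : ℝ := max R R1 with hR2
  set m : ℝ := (1 + R2 ^ 2) ^ (-((N:ℝ) + 2 * s) / 2) with hm
  have hm0 : 0 < m := by positivity
  have hB0 : 0 ≤ B := (abs_nonneg _).trans (hB 0)
  set K : ℝ := (B + |a|) / m with hK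
  have hK0 : 0 ≤ K := by positivity
  have hscale : secd N s (fun x => a * hAux N β x + K * Φ x) =
      fun x z => a * secd N s (hAux N β) x z + K * secd N s Φ x z := by
    funext x z; simp only [secd]; ring
  have hh0 : Tendsto (hAux N β) (atInfty N) (nhds 0) := by
    simpa using hAux_lim N hβ (one_pos (α := ℝ))
  have main := comparison_principle N (s := s) (R := R2) hc hlam hu
    (w := fun x => a * hAux N β x + K * Φ x)
    ((continuous_const.mul (hAux_cont N β)).add
      (continuous_const.mul ((hAux_cont N _).comp (continuous_const_smul ε))))
    hu0 (by simpa using (hh0.const_mul a).add ((hAux_lim N hβ' hε).const_mul K))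
    (fun x hx => hui x ((le_max_left _ _).trans_lt hx))
    (fun x _ => by
      rw [hscale]; exact ((hest x).1.const_mul a).add ((hbar x).1.const_mul K))
    (fun x hx => by
      rw [hsol x ((le_max_left _ _).trans_lt hx), hscale,
        integral_add ((hest x).1.const_mul a) ((hbar x).1.const_mul K),
        integral_const_mul, integral_const_mul]
      have h2 : 0 < Φ x := hAux_pos N _ (ε • x)
      have h3 := (abs_le.1 (hbar x).2).2
      have h4 : c * ∫ z, secd N s Φ x z ≤ lam * Φ x := by
        calc c * ∫ z, secd N s Φ x z ≤ c * (lam / (c + 1) * Φ x) := by gcongr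
          _ = c / (c + 1) * (lam * Φ x) := by field_simp
          _ ≤ 1 * (lam * Φ x) := by
              gcongr
              rw [div_le_one (by positivity)]; linarith
          _ = _ := one_mul _
      have h5 := mul_le_mul_of_nonneg_left h4 hK0
      have hx0 := hAux_pos N β x
      have h6 : c * (a * ∫ z, secd N s (hAux N β) x z) ≤ lam * (δ / 2) * hAux N β x := by
        calc c * (a * ∫ z, secd N s (hAux N β) x z)
            ≤ c * (|a| * |∫ z, secd N s (hAux N β) x z|) := by
              rw [← abs_mul]; gcongr; exact le_abs_self _
          _ ≤ c * (|a| * (C * (1 + ‖x‖ ^ 2) ^ (-η / 2) * hAux N β x)) := by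
              gcongr; exact (hest x).2
          _ = |a| * c * (C * (1 + ‖x‖ ^ 2) ^ (-η / 2)) * hAux N β x := by ring
          _ ≤ _ := by
              exact mul_le_mul_of_nonneg_right
                (hR1 ‖x‖ ((le_max_right _ _).trans hx.le) x rfl).le hx0.le
      have h7 : lam * a = κ + lam * (δ / 2) := by rw [ha]; field_simp
      have h8 : lam * (a * hAux N β x) = κ * hAux N β x + lam * (δ / 2) * hAux N β x := by
        rw [← mul_assoc, h7]; ring
      nlinarith)
    (fun x hx => by
      have h1 : m ≤ Φ x := by
        simp only [hm, hΦ, hAux]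
        apply Real.rpow_le_rpow_of_nonpos (by positivity) _ (by linarith)
        rw [norm_smul, Real.norm_of_nonneg hε.le]
        have : ε * ‖x‖ ≤ R2 := (mul_le_of_le_one_left (norm_nonneg x) hε1).trans hx
        gcongr
      have h2 : K * m = B + |a| := by rw [hK]; field_simp
      have h3 : B + |a| ≤ K * Φ x := by
        rw [← h2]; gcongr
      have h4 : hAux N β x ≤ 1 := by
        unfold hAux
        exact Real.rpow_le_one_of_one_le_of_nonpos (by nlinarith [sq_nonneg ‖x‖]) (by linarith)
      have h5 : -|a| ≤ a * hAux N β x := by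
        have hx0 := hAux_pos N β x
        have : |a * hAux N β x| ≤ |a| := by
          rw [abs_mul, abs_of_pos hx0]
          exact mul_le_of_le_one_right (abs_nonneg a) h4
        exact (abs_le.1 this).1.trans' (le_refl _)
      have h6 := (le_abs_self _).trans (hB x)
      linarith)
  have hlim : Tendsto (fun x => a * (hAux N β x * ‖x‖ ^ β) + K * (Φ x * ‖x‖ ^ β)) (atInfty N)
      (nhds a) := by
    simpa using (((hAux_lim1 N (β := β)).const_mul a).add
      ((hAux_lim0 N hβ2 hβ' hε).const_mul K))
  filter_upwards [hlim.eventually (gt_mem_nhds (show a < κ / lam + δ by rw [ha]; linarith))]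
    with x hx
  refine lt_of_le_of_lt ?_ hx
  calc u x * ‖x‖ ^ β ≤ (a * hAux N β x + K * Φ x) * ‖x‖ ^ β := by gcongr; exact main x
    _ = _ := by ring

lemma Cns_nonneg (N : ℕ) {s : ℝ} (hs : 0 < s) : 0 ≤ Cns N s := by
  unfold Cns
  have : 0 ≤ Real.Gamma (((N : ℝ) + 2 * s) / 2) := Real.Gamma_nonneg_of_nonneg (by positivity)
  have := Real.pi_pos
  positivity

theorem comparison_asymptotics
    (N : ℕ) (hN : 2 ≤ N) (s lam γ ρ β : ℝ)
    (hs : s ∈ Set.Ioo (0 : ℝ) 1) (hlam : 0 < lam) (hγ : 0 < γ) (hρ : 0 < ρ)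
    (hβ : β ∈ Set.Ioc ((N : ℝ) / 2) ((N : ℝ) + 2 * s))
    (u : En N → ℝ) (huc : Continuous u) (hub : ∃ B : ℝ, ∀ x, |u x| ≤ B)
    (hu0 : Filter.Tendsto u (atInfty N) (nhds 0))
    (hker : ∀ x : En N, ρ < ‖x‖ →
      Integrable (fun z : En N =>
        (u (x + z) + u (x - z) - 2 * u x) / ‖z‖ ^ ((N : ℝ) + 2 * s)))
    (hsol : ∀ x : En N, ρ < ‖x‖ →
      fracLap N s u x + lam * u x = γ * hAux N β x) :
    Filter.limsup (fun x => ((u x * ‖x‖ ^ β : ℝ) : EReal)) (atInfty N) < ⊤ ∧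
    (β < (N : ℝ) + 2 * s →
      Filter.Tendsto (fun x => u x * ‖x‖ ^ β) (atInfty N) (nhds (γ / lam))) := by

  have hs0 := hs.1
  have hβ0 : 0 < β := lt_of_le_of_lt (by positivity) hβ.1
  have hc : 0 ≤ Cns N s / 2 := by have := Cns_nonneg N hs0; positivity
  have hsol1 : ∀ x, ρ < ‖x‖ →
      -(Cns N s / 2) * (∫ z, secd N s u x z) + lam * u x = γ * hAux N β x := hsol
  constructor
  · obtain ⟨K, hK⟩ := upper1 N hN hs hc hlam hβ0 hβ.2 hγ huc hub hu0 hker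
      (fun x hx => (hsol1 x hx).le)
    refine lt_of_le_of_lt ?_ (EReal.coe_lt_top K)
    refine Filter.limsup_le_of_le (by isBoundedDefault) (Eventually.of_forall fun x => ?_)
    exact EReal.coe_le_coe_iff.2 (hK x)
  · intro hβ2
    have hneg : secd N s (fun x => - u x) = fun x z => - secd N s u x z := by
      funext x z; simp only [secd]; ring
    have hup := fun δ hδ => upper2 N hN hs hc hlam hβ0 hβ2 huc hub hu0 hker hsol1 (δ := δ) hδ
    have hlo := fun δ hδ => upper2 N hN (u := fun x => - u x) (R := ρ) (κ := -γ) hs hc hlam hβ0 hβ2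
      huc.neg (by simpa using hub) (by simpa using hu0.neg)
      (fun x hx => by rw [hneg]; exact (hker x hx).neg)
      (fun x hx => by
        rw [hneg, integral_neg]
        linear_combination - hsol1 x hx) (δ := δ) hδ
    rw [Metric.tendsto_nhds]
    intro δ hδ
    filter_upwards [hup δ hδ, hlo δ hδ] with x h1 h2
    rw [Real.dist_eq, abs_lt]
    rw [neg_div] at h2
    constructor <;> linarith

end
end
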